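/- arXiv:2010.11519 — 2 statements merged into one kernel-verified Lean document; each statement's English description precedes it below -/
import Mathlib

section
/- (Upper bound.) Let (ε_N)_N be a positive sequence vanishing at infinity, let μ⁰_N ∈ P_N(Ω) converge narrowly to μ⁰, and assume τ_N = o(ε_N) and W₂²(μ⁰_N, μ⁰) = o(ε_N) as N → ∞. Then for any sequence (Q_N)_N where Q_N is a minimizer of the discrete problem (M_{N, μ⁰_N, ε_N}), one has limsup_{N→∞} J_{ε_N}(Q_N) ≤ J(Q_min). -/
open MeasureTheory Filter Topology Set
open scoped ENNReal NNReal

noncomputable section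

abbrev Euc (d : ℕ) : Type := EuclideanSpace ℝ (Fin d)

abbrev Traj (d : ℕ) (T : ℝ) : Type := C(Set.Icc (0:ℝ) T, Euc d)

instance (d : ℕ) (T : ℝ) : MeasurableSpace (Traj d T) := borel _
instance (d : ℕ) (T : ℝ) : BorelSpace (Traj d T) := ⟨rfl⟩

/-- evaluation of a trajectory at time `t ∈ ℝ` (projected onto `[0,T]`). -/
def evalAt {d : ℕ} {T : ℝ} (hT : 0 ≤ T) (t : ℝ) (γ : Traj d T) : Euc d :=
  γ (Set.projIcc 0 T hT t)

/-- Narrow convergence of a sequence of measures. -/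
def NarrowTendsto {X : Type*} [TopologicalSpace X] [MeasurableSpace X]
    (μ : ℕ → Measure X) (ν : Measure X) : Prop :=
  ∀ f : BoundedContinuousFunction X ℝ,
    Tendsto (fun n => ∫ x, f x ∂(μ n)) atTop (𝓝 (∫ x, f x ∂ν))

/-- Squared 2-Wasserstein distance. -/
def W2sq {X : Type*} [MeasurableSpace X] [PseudoMetricSpace X]
    (μ ν : Measure X) : ℝ≥0∞ :=
  ⨅ (π : Measure (X × X)) (_ : π.map Prod.fst = μ ∧ π.map Prod.snd = ν),
    ∫⁻ p, ENNReal.ofReal (dist p.1 p.2 ^ 2) ∂π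

/-- Uniform discrete probability measures on `N` points. -/
def IsUnifDiscrete {X : Type*} [MeasurableSpace X] (N : ℕ) (μ : Measure X) : Prop :=
  ∃ x : Fin N → X, μ = ((N : ℝ≥0∞))⁻¹ • ∑ i, MeasureTheory.Measure.dirac (x i)

/-- Shifted (by `+C`) kinetic action: equals `∫₀ᵀ (L(γ'(t)) + C) dt` if `γ ∈ W^{1,r}`,
`+∞` otherwise. -/
def actionN {d : ℕ} {T : ℝ} (L : Euc d → ℝ) (C : ℝ) (γ : Traj d T) : ℝ≥0∞ :=
  sInf { a : ℝ≥0∞ | ∃ g : ℝ → Euc d, IntervalIntegrable g volume 0 T ∧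
      (∀ s t : Set.Icc (0:ℝ) T, γ t - γ s = ∫ u in (s:ℝ)..(t:ℝ), g u) ∧
      a = ∫⁻ t in Set.Ioc (0:ℝ) T, ENNReal.ofReal (L (g t) + C) }

/-- Kinetic part of the energy: `∫_Γ L(γ) dQ(γ)`. -/
def kinE {d : ℕ} {T : ℝ} (L : Euc d → ℝ) (C : ℝ) (Q : Measure (Traj d T)) : EReal :=
  ((∫⁻ γ, actionN L C γ ∂Q : ℝ≥0∞) : EReal) - ((C * T : ℝ) : EReal)

/-- The mean-field game energy `J`. -/
def Jfun {d : ℕ} {T : ℝ} (hT : 0 ≤ T) (L : Euc d → ℝ) (C : ℝ)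
    (F : Measure (Euc d) → ℝ≥0∞) (G : Measure (Traj d T) → ℝ)
    (Q : Measure (Traj d T)) : EReal :=
  kinE L C Q
    + ((∫⁻ t in Set.Ioc (0:ℝ) T, F (Q.map (evalAt hT t)) : ℝ≥0∞) : EReal)
    + ((G Q : ℝ) : EReal)

/-- Moreau envelope of `F` with parameter `ε` in the 2-Wasserstein space. -/
def moreau {d : ℕ} (Ω : Set (Euc d)) (F : Measure (Euc d) → ℝ≥0∞) (ε : ℝ)
    (μ : Measure (Euc d)) : ℝ≥0∞ :=
  ⨅ (ρ : Measure (Euc d)) (_ : IsProbabilityMeasure ρ ∧ ρ Ωᶜ = 0),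
    W2sq μ ρ / ENNReal.ofReal (2 * ε) + F ρ

/-- The regularized energy `J_ε`. -/
def Jeps {d : ℕ} {T : ℝ} (hT : 0 ≤ T) (Ω : Set (Euc d)) (L : Euc d → ℝ) (C : ℝ)
    (F : Measure (Euc d) → ℝ≥0∞) (G : Measure (Traj d T) → ℝ) (ε : ℝ)
    (Q : Measure (Traj d T)) : EReal :=
  kinE L C Q
    + ((∫⁻ t in Set.Ioc (0:ℝ) T, moreau Ω F ε (Q.map (evalAt hT t)) : ℝ≥0∞) : EReal)
    + ((G Q : ℝ) : EReal)

end

lemma jensen_lint {α E : Type*} [MeasurableSpace α] [NormedAddCommGroup E] [NormedSpace ℝ E]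
    [CompleteSpace E]
    (μ : Measure α) [IsFiniteMeasure μ] [NeZero μ] (f : α → E) (hf : Integrable f μ)
    (φ : E → ℝ) (hφ : ConvexOn ℝ Set.univ φ) (hφc : Continuous φ) (h0 : ∀ x, 0 ≤ φ x) :
    μ Set.univ * ENNReal.ofReal (φ (⨍ x, f x ∂μ)) ≤ ∫⁻ x, ENNReal.ofReal (φ (f x)) ∂μ := by
  by_cases htop : ∫⁻ x, ENNReal.ofReal (φ (f x)) ∂μ = ⊤
  · rw [htop]; exact le_top
  have hm : AEStronglyMeasurable (φ ∘ f) μ := hφc.comp_aestronglyMeasurable hf.1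
  have hi : Integrable (φ ∘ f) μ := by
    refine ⟨hm, ?_⟩
    rw [hasFiniteIntegral_iff_ofReal (f := φ ∘ f) (Eventually.of_forall fun x => h0 _)]
    exact lt_of_le_of_ne le_top htop
  have h := hφ.map_average_le hφc.continuousOn isClosed_univ (by simp) hf hi
  have hpos : 0 < μ.real univ := measureReal_univ_pos
  have h2 : μ.real univ * φ (⨍ x, f x ∂μ) ≤ ∫ x, φ (f x) ∂μ := by
    rw [average_eq μ (fun x => φ (f x)), smul_eq_mul] at h
    calc _ ≤ μ.real univ * ((μ.real univ)⁻¹ * ∫ x, φ (f x) ∂μ) := by gcongr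
      _ = _ := by field_simp
  have e := ofReal_integral_eq_lintegral_ofReal hi (Eventually.of_forall fun x => h0 _)
  have e2 : ∫⁻ x, ENNReal.ofReal (φ (f x)) ∂μ = ENNReal.ofReal (∫ x, φ (f x) ∂μ) := e.symm
  rw [e2, ← ENNReal.ofReal_toReal (measure_ne_top μ univ), ← ENNReal.ofReal_mul ENNReal.toReal_nonneg]
  exact ENNReal.ofReal_le_ofReal h2

noncomputable def AE {d : ℕ} {T : ℝ} (hT : 0 ≤ T) (L : Euc d → ℝ) (C : ℝ) (E : ℕ × (ℕ → ℝ × ℝ))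
    (γ : Traj d T) : ℝ≥0∞ :=
  ∑ i ∈ Finset.range E.1, ENNReal.ofReal (dist (E.2 i).1 (E.2 i).2) *
    ENNReal.ofReal (L (((E.2 i).2 - (E.2 i).1)⁻¹ •
      (evalAt hT (E.2 i).2 γ - evalAt hT (E.2 i).1 γ)) + C)

lemma evalAt_of_mem {d : ℕ} {T : ℝ} (hT : 0 ≤ T) {t : ℝ} (ht : t ∈ Set.Icc 0 T) (γ : Traj d T) :
    evalAt hT t γ = γ ⟨t, ht⟩ := by
  simp [evalAt, Set.projIcc_of_mem hT ht]

lemma continuous_evalAt {d : ℕ} {T : ℝ} (hT : 0 ≤ T) (t : ℝ) :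
    Continuous (evalAt (d := d) hT t) := by
  unfold evalAt; fun_prop

lemma AE_le_action {d : ℕ} {T : ℝ} (hT : 0 ≤ T) (L : Euc d → ℝ) (C : ℝ)
    (hL : ConvexOn ℝ Set.univ L) (hLc : Continuous L) (h0 : ∀ p, 0 ≤ L p + C)
    (E : ℕ × (ℕ → ℝ × ℝ)) (hE : E ∈ AbsolutelyContinuousOnInterval.disjWithin 0 T)
    (γ : Traj d T) : AE hT L C E γ ≤ actionN L C γ := by
  refine le_sInf ?_
  rintro a ⟨g, hg, hγ, rfl⟩
  have hconv : ConvexOn ℝ Set.univ (fun p => L p + C) := hL.add_const C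
  have hcell : ∀ i ∈ Finset.range E.1, ENNReal.ofReal (dist (E.2 i).1 (E.2 i).2) *
    ENNReal.ofReal (L (((E.2 i).2 - (E.2 i).1)⁻¹ •
      (evalAt hT (E.2 i).2 γ - evalAt hT (E.2 i).1 γ)) + C) ≤
      ∫⁻ t in Set.uIoc (E.2 i).1 (E.2 i).2, ENNReal.ofReal (L (g t) + C) := by
    intro i hi
    have hm := hE.1 i hi
    have hsub : Set.uIoc (E.2 i).1 (E.2 i).2 ⊆ Set.uIoc 0 T :=
      AbsolutelyContinuousOnInterval.uIoc_subset_of_mem_disjWithin hE (Finset.mem_range.1 hi)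
    set a := (E.2 i).1
    set b := (E.2 i).2
    rw [Set.uIcc_of_le hT] at hm
    by_cases hab : a = b
    · simp [hab]
    have hvol : volume (Set.uIoc a b) = ENNReal.ofReal (dist a b) := by
      rw [Set.uIoc, Real.volume_Ioc, max_sub_min_eq_abs', Real.dist_eq]
    have : NeZero (volume.restrict (Set.uIoc a b)) := ⟨by
      rw [Ne, Measure.restrict_eq_zero, hvol]
      simpa using hab⟩
    have : IsFiniteMeasure (volume.restrict (Set.uIoc a b)) := ⟨by
      rw [Measure.restrict_apply_univ, hvol]; exact ENNReal.ofReal_lt_top⟩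
    have hgi : Integrable g (volume.restrict (Set.uIoc a b)) := by
      have := intervalIntegrable_iff.1 hg
      exact this.mono_set hsub
    have := jensen_lint (volume.restrict (Set.uIoc a b)) g hgi (fun p => L p + C) hconv
      (by fun_prop) h0
    rw [Measure.restrict_apply_univ, hvol] at this
    rw [evalAt_of_mem hT hm.1, evalAt_of_mem hT hm.2, hγ, ← interval_average_eq]
    exact this
  calc AE hT L C E γ ≤ ∑ i ∈ Finset.range E.1,
        ∫⁻ t in Set.uIoc (E.2 i).1 (E.2 i).2, ENNReal.ofReal (L (g t) + C) :=
        Finset.sum_le_sum hcell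
    _ = ∫⁻ t in ⋃ i ∈ Finset.range E.1, Set.uIoc (E.2 i).1 (E.2 i).2,
          ENNReal.ofReal (L (g t) + C) := by
        rw [lintegral_biUnion_finset hE.2 (fun i _ => measurableSet_uIoc)]
    _ ≤ _ := by
        apply lintegral_mono_set
        have := AbsolutelyContinuousOnInterval.biUnion_uIoc_subset_of_mem_disjWithin
          (n := E.1) (I := E.2) hE
        rwa [Set.uIoc_of_le hT] at this

lemma AE_continuous {d : ℕ} {T : ℝ} (hT : 0 ≤ T) (L : Euc d → ℝ) (C : ℝ)
    (hLc : Continuous L) (E : ℕ × (ℕ → ℝ × ℝ)) :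
    Continuous (AE (d := d) hT L C E) := by
  unfold AE
  refine continuous_finsetSum _ fun i _ => ?_
  refine ENNReal.continuous_const_mul ENNReal.ofReal_ne_top |>.comp ?_
  have := continuous_evalAt (d := d) hT (E.2 i).1
  have := continuous_evalAt (d := d) hT (E.2 i).2
  exact ENNReal.continuous_ofReal.comp (by fun_prop)

lemma AE_jensen {d : ℕ} {T : ℝ} (hT : 0 ≤ T) (L : Euc d → ℝ) (C : ℝ)
    (hL : ConvexOn ℝ Set.univ L) (hLc : Continuous L) (h0 : ∀ p, 0 ≤ L p + C)
    (E : ℕ × (ℕ → ℝ × ℝ)) {H : Type*} [NormedAddCommGroup H] [NormedSpace ℝ H] [CompleteSpace H]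
    [MeasurableSpace H] [BorelSpace H]
    (ι : H →L[ℝ] Traj d T) (ν : Measure H) [IsProbabilityMeasure ν]
    (hν : Integrable (fun y => y) ν) :
    AE hT L C E (ι (∫ y, y ∂ν)) ≤ ∫⁻ y, AE hT L C E (ι y) ∂ν := by
  have hconv : ConvexOn ℝ Set.univ (fun p => L p + C) := hL.add_const C
  unfold AE
  have hcm : ∀ t, Continuous fun y => evalAt hT t (ι y) := fun t =>
    (continuous_evalAt hT t).comp ι.continuous
  have hmeas : ∀ i, Measurable (fun y => ENNReal.ofReal (L (((E.2 i).2 - (E.2 i).1)⁻¹ •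
      (evalAt hT (E.2 i).2 (ι y) - evalAt hT (E.2 i).1 (ι y))) + C)) := by
    intro i
    have := hcm (E.2 i).1
    have := hcm (E.2 i).2
    exact (ENNReal.continuous_ofReal.comp (by fun_prop)).measurable
  rw [lintegral_finsetSum _ (fun i _ => (hmeas i).const_mul _)]
  refine Finset.sum_le_sum fun i _ => ?_
  rw [lintegral_const_mul _ (hmeas i)]
  gcongr
  let ev : ℝ → H →L[ℝ] Euc d := fun t =>
    (ContinuousMap.evalCLM ℝ (Set.projIcc 0 T hT t)).comp ι
  let Λ : H →L[ℝ] Euc d := ((E.2 i).2 - (E.2 i).1)⁻¹ • (ev (E.2 i).2 - ev (E.2 i).1)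
  have hΛ : ∀ y, ((E.2 i).2 - (E.2 i).1)⁻¹ •
      (evalAt hT (E.2 i).2 (ι y) - evalAt hT (E.2 i).1 (ι y)) = Λ y := by
    intro y; simp [Λ, ev, evalAt]
  simp_rw [hΛ]
  have := jensen_lint ν Λ (Λ.integrable_comp hν) (fun p => L p + C) hconv (by fun_prop) h0
  rw [average_eq_integral, Λ.integral_comp_comm hν, measure_univ, one_mul] at this
  exact this

lemma straddle {E : Type*} [NormedAddCommGroup E] [NormedSpace ℝ E] {f : ℝ → E} {f' : E} {t : ℝ}
    (hf : HasDerivAt f f' t) (a b : ℕ → ℝ) (ha : ∀ n, a n ≤ t) (hb : ∀ n, t ≤ b n)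
    (hab : ∀ n, a n < b n) (hlim : Tendsto (fun n => b n - a n) atTop (𝓝 0)) :
    Tendsto (fun n => (b n - a n)⁻¹ • (f (b n) - f (a n))) atTop (𝓝 f') := by
  have hat : Tendsto a atTop (𝓝 t) := by
    refine tendsto_of_tendsto_of_tendsto_of_le_of_le (g := fun n => t - (b n - a n))
      (h := fun n => t) ?_ tendsto_const_nhds (fun n => ?_) ha
    · simpa using hlim.const_sub t
    · have := hb n; simp only; linarith
  have hbt : Tendsto b atTop (𝓝 t) := by
    refine tendsto_of_tendsto_of_tendsto_of_le_of_le (h := fun n => t + (b n - a n))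
      (g := fun n => t) tendsto_const_nhds ?_ hb (fun n => ?_)
    · simpa using hlim.const_add t
    · have := ha n; simp only; linarith
  rw [hasDerivAt_iff_isLittleO] at hf
  rw [Metric.tendsto_atTop']
  intro ε hε
  have h1 := hf.def (half_pos hε)
  obtain ⟨N1, h2⟩ := eventually_atTop.1 (hat.eventually h1)
  obtain ⟨N2, h3⟩ := eventually_atTop.1 (hbt.eventually h1)
  refine ⟨max N1 N2, fun n hn => ?_⟩
  have h2 := h2 n (by have := le_max_left N1 N2; omega)
  have h3 := h3 n (by have := le_max_right N1 N2; omega)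
  have hpos : 0 < b n - a n := sub_pos.2 (hab n)
  have e : (b n - a n)⁻¹ • (f (b n) - f (a n)) - f' = (b n - a n)⁻¹ •
      ((f (b n) - f t - (b n - t) • f') - (f (a n) - f t - (a n - t) • f')) := by
    have : f' = (b n - a n)⁻¹ • ((b n - a n) • f') := by
      rw [smul_smul, inv_mul_cancel₀ hpos.ne', one_smul]
    conv_lhs => rw [this]
    rw [← smul_sub]
    congr 1
    module
  rw [dist_eq_norm, e, norm_smul, norm_inv, Real.norm_of_nonneg hpos.le, inv_mul_lt_iff₀ hpos]
  rw [Real.norm_of_nonneg (by linarith [hb n])] at h3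
  rw [Real.norm_of_nonpos (by linarith [ha n])] at h2
  calc _ ≤ _ := norm_sub_le _ _
    _ ≤ ε / 2 * (b n - t) + ε / 2 * (-(a n - t)) := add_le_add h3 h2
    _ < (b n - a n) * ε := by nlinarith

lemma superlin {d : ℕ} {r C : ℝ} (hr : 1 < r) (hC : 0 < C) {L : Euc d → ℝ}
    (hlow : ∀ p : Euc d, 1 / (r * C) * ‖p‖ ^ r - C ≤ L p) {η : ℝ} (hη : 0 < η) :
    ∃ K > 0, ∀ p, ‖p‖ ≤ K + η * (L p + C) := by
  have hq : 0 < r * C / η := by positivity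
  refine ⟨(r * C / η) ^ (1 / (r - 1)), by positivity, fun p => ?_⟩
  have h0 : 0 ≤ L p + C := by
    have := hlow p
    have h : 0 ≤ 1 / (r * C) * ‖p‖ ^ r := by positivity
    linarith
  by_cases hp : ‖p‖ ≤ (r * C / η) ^ (1 / (r - 1))
  · have := mul_nonneg hη.le h0; linarith
  push Not at hp
  have hppos : 0 < ‖p‖ := lt_trans (by positivity) hp
  have h1 : r * C / η ≤ ‖p‖ ^ (r - 1) := by
    calc r * C / η = ((r * C / η) ^ (1 / (r - 1))) ^ (r - 1) := by
          rw [← Real.rpow_mul hq.le, one_div, inv_mul_cancel₀ (by linarith), Real.rpow_one]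
      _ ≤ _ := Real.rpow_le_rpow (by positivity) hp.le (by linarith)
  have h2 : ‖p‖ ^ r = ‖p‖ ^ (r - 1) * ‖p‖ := by
    conv_rhs => rw [← Real.rpow_add_one hppos.ne']
    simp
  have h3 := hlow p
  have h4 : ‖p‖ ≤ η * (1 / (r * C) * ‖p‖ ^ r) := by
    rw [h2]
    calc ‖p‖ = η * (1 / (r * C) * ((r * C / η) * ‖p‖)) := by
          have : (0:ℝ) < r := by linarith
          field_simp
      _ ≤ _ := by gcongr
  have h5 : η * (1 / (r * C) * ‖p‖ ^ r) ≤ η * (L p + C) := by gcongr; linarith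
  have : 0 < (r * C / η) ^ (1 / (r - 1)) := by positivity
  linarith

lemma lintegral_cells (h : ℝ) (hh : 0 < h) (Φ : ℝ → ℝ≥0∞) (m : ℕ) :
    ∫⁻ t in Set.Ioc 0 (h * m), Φ t = ∑ i ∈ Finset.range m,
      ∫⁻ t in Set.Ioc (h * i) (h * (i + 1)), Φ t := by
  induction m with
  | zero => simp
  | succ m ih =>
    rw [Finset.sum_range_succ, ← ih, ← lintegral_union measurableSet_Ioc]
    · rw [Set.Ioc_union_Ioc_eq_Ioc (by positivity) (by nlinarith)]
      push_cast; rfl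
    · rw [Set.disjoint_left]; rintro x ⟨_, h1⟩ ⟨h2, _⟩; linarith

lemma action_ac {d : ℕ} {T : ℝ} (hT : 0 ≤ T) (L : Euc d → ℝ) {r C : ℝ} (hr : 1 < r) (hC : 0 < C)
    (hlow : ∀ p : Euc d, 1 / (r * C) * ‖p‖ ^ r - C ≤ L p) (γ : Traj d T) (M : ℝ)
    (hM : ∀ E ∈ AbsolutelyContinuousOnInterval.disjWithin 0 T,
      AE hT L C E γ ≤ ENNReal.ofReal M) :
    AbsolutelyContinuousOnInterval (fun t => evalAt hT t γ) 0 T := by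
  have h0 : ∀ p, 0 ≤ L p + C := fun p => by
    have := hlow p
    have h : 0 ≤ 1 / (r * C) * ‖p‖ ^ r := by positivity
    linarith
  rw [absolutelyContinuousOnInterval_iff]
  intro ε hε
  obtain ⟨K, hK, hKp⟩ := superlin hr hC hlow (η := ε / (2 * (|M| + 1))) (by positivity)
  refine ⟨ε / (2 * K), by positivity, fun E hE hlen => ?_⟩
  have h1 := hM E hE
  set S := ∑ i ∈ Finset.range E.1, dist (E.2 i).1 (E.2 i).2 * (L (((E.2 i).2 - (E.2 i).1)⁻¹ •
      (evalAt hT (E.2 i).2 γ - evalAt hT (E.2 i).1 γ)) + C) with hS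
  have hSn : ∀ i ∈ Finset.range E.1, 0 ≤ dist (E.2 i).1 (E.2 i).2 *
      (L (((E.2 i).2 - (E.2 i).1)⁻¹ •
      (evalAt hT (E.2 i).2 γ - evalAt hT (E.2 i).1 γ)) + C) := fun i _ =>
    mul_nonneg dist_nonneg (h0 _)
  have hAE : AE hT L C E γ = ENNReal.ofReal S := by
    rw [hS, ENNReal.ofReal_sum_of_nonneg hSn]
    unfold AE
    refine Finset.sum_congr rfl fun i _ => ?_
    rw [ENNReal.ofReal_mul dist_nonneg]
  have hSM : S ≤ |M| := by
    rw [hAE] at h1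
    have := ENNReal.ofReal_le_ofReal_iff'.1 h1
    rcases this with h | h
    · exact h.trans (le_abs_self M)
    · exact h.trans (abs_nonneg M)
  have hterm : ∀ i ∈ Finset.range E.1, dist (evalAt hT (E.2 i).1 γ) (evalAt hT (E.2 i).2 γ) ≤
      K * dist (E.2 i).1 (E.2 i).2 + ε / (2 * (|M| + 1)) * (dist (E.2 i).1 (E.2 i).2 *
      (L (((E.2 i).2 - (E.2 i).1)⁻¹ •
      (evalAt hT (E.2 i).2 γ - evalAt hT (E.2 i).1 γ)) + C)) := by
    intro i _
    by_cases hab : (E.2 i).1 = (E.2 i).2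
    · simp [hab]
    have := hKp (((E.2 i).2 - (E.2 i).1)⁻¹ • (evalAt hT (E.2 i).2 γ - evalAt hT (E.2 i).1 γ))
    have hd : 0 < dist (E.2 i).1 (E.2 i).2 := dist_pos.2 hab
    have e : dist (evalAt hT (E.2 i).1 γ) (evalAt hT (E.2 i).2 γ) = dist (E.2 i).1 (E.2 i).2 *
        ‖((E.2 i).2 - (E.2 i).1)⁻¹ • (evalAt hT (E.2 i).2 γ - evalAt hT (E.2 i).1 γ)‖ := by
      rw [norm_smul, norm_inv, ← dist_eq_norm, ← dist_eq_norm, dist_comm (E.2 i).2,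
        dist_comm (evalAt hT (E.2 i).2 γ)]
      field_simp
    rw [e]
    calc _ ≤ dist (E.2 i).1 (E.2 i).2 * _ := mul_le_mul_of_nonneg_left this hd.le
      _ = _ := by ring
  calc _ ≤ _ := Finset.sum_le_sum hterm
    _ = K * (∑ i ∈ Finset.range E.1, dist (E.2 i).1 (E.2 i).2) + ε / (2 * (|M| + 1)) * S := by
      rw [Finset.sum_add_distrib, Finset.mul_sum, hS, Finset.mul_sum]
    _ < K * (ε / (2 * K)) + ε / (2 * (|M| + 1)) * (|M| + 1) := by
      refine add_lt_add_of_lt_of_le (mul_lt_mul_of_pos_left hlen hK) ?_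
      gcongr
      linarith
    _ = ε := by field_simp; ring

lemma action_le_iSup {d : ℕ} {T : ℝ} (hT : 0 < T) (L : Euc d → ℝ) {r C : ℝ} (hr : 1 < r)
    (hC : 0 < C) (hLc : Continuous L)
    (hlow : ∀ p : Euc d, 1 / (r * C) * ‖p‖ ^ r - C ≤ L p) (γ : Traj d T) :
    actionN L C γ ≤ ⨆ E ∈ AbsolutelyContinuousOnInterval.disjWithin 0 T, AE hT.le L C E γ := by
  set S := ⨆ E ∈ AbsolutelyContinuousOnInterval.disjWithin 0 T, AE hT.le L C E γ with hS
  have hle : ∀ E ∈ AbsolutelyContinuousOnInterval.disjWithin 0 T, AE hT.le L C E γ ≤ S :=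
    fun E hE => le_iSup₂ (f := fun E (_ : E ∈ AbsolutelyContinuousOnInterval.disjWithin 0 T) =>
      AE hT.le L C E γ) E hE
  by_cases htop : S = ⊤
  · rw [htop]; exact le_top
  have h0 : ∀ p, 0 ≤ L p + C := fun p => by
    have := hlow p
    have h : 0 ≤ 1 / (r * C) * ‖p‖ ^ r := by positivity
    linarith
  set f : ℝ → Euc d := fun t => evalAt hT.le t γ with hf
  have hac : AbsolutelyContinuousOnInterval f 0 T :=
    action_ac hT.le L hr hC hlow γ S.toReal (fun E hE => by
      rw [ENNReal.ofReal_toReal htop]; exact hle E hE)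
  have hdiff : ∀ᵐ x, x ∈ Set.uIcc 0 T → DifferentiableAt ℝ f x :=
    hac.boundedVariationOn.ae_differentiableAt_of_mem_uIcc
  set g : ℝ → Euc d := deriv f with hg
  have hgm : Measurable g := measurable_deriv f
  -- step functions
  let h : ℕ → ℝ := fun n => T / (n + 1)
  have hh : ∀ n, 0 < h n := fun n => by positivity
  let k : ℕ → ℝ → ℤ := fun n t => ⌈t / h n⌉
  let gn : ℕ → ℝ → Euc d := fun n t =>
    (h n * k n t - h n * (k n t - 1))⁻¹ • (f (h n * k n t) - f (h n * (k n t - 1)))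
  have hgnm : ∀ n, Measurable (gn n) := by
    intro n
    have h1 : Measurable (k n) := Int.measurable_ceil.comp (measurable_id.div_const _)
    exact (measurable_from_top (f := fun z : ℤ =>
      (h n * z - h n * (z - 1))⁻¹ • (f (h n * z) - f (h n * (z - 1))))).comp h1
  have hconv : ∀ᵐ t ∂(volume.restrict (Set.Ioc 0 T)),
      Tendsto (fun n => gn n t) atTop (𝓝 (g t)) := by
    rw [ae_restrict_iff' measurableSet_Ioc]
    filter_upwards [hdiff] with t ht htm
    have htd := (ht (by rw [Set.uIcc_of_le hT.le]; exact Set.Ioc_subset_Icc_self htm)).hasDerivAt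
    refine straddle htd (fun n => h n * (k n t - 1)) (fun n => h n * k n t) ?_ ?_ ?_ ?_
    · intro n
      have := Int.ceil_lt_add_one (t / h n)
      have h2 : ((k n t : ℝ) - 1) ≤ t / h n := by simp only [k]; linarith
      calc _ ≤ h n * (t / h n) := mul_le_mul_of_nonneg_left h2 (hh n).le
        _ = t := by have := (hh n).ne'; field_simp
    · intro n
      have := Int.le_ceil (t / h n)
      calc t = h n * (t / h n) := by have := (hh n).ne'; field_simp
        _ ≤ _ := mul_le_mul_of_nonneg_left this (hh n).le
    · intro n
      have := hh n
      nlinarith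
    · have : (fun n => h n * k n t - h n * (k n t - 1)) = h := by ext n; ring
      rw [this]
      have := (tendsto_const_div_atTop_nhds_zero_nat T).comp (tendsto_add_atTop_nat 1)
      refine this.congr fun n => ?_
      simp [h]
  have hint : ∀ n, ∫⁻ t in Set.Ioc 0 T, ENNReal.ofReal (L (gn n t) + C) ≤ S := by
    intro n
    let E : ℕ × (ℕ → ℝ × ℝ) := (n + 1, fun i => (h n * i, h n * (i + 1)))
    have hlt : ∀ i : ℕ, h n * i < h n * (i + 1) := fun i => by have := hh n; nlinarith
    have hTn : h n * ((n + 1 : ℕ) : ℝ) = T := by simp only [h]; push_cast; field_simp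
    have hE : E ∈ AbsolutelyContinuousOnInterval.disjWithin 0 T := by
      refine ⟨fun i hi => ?_, ?_⟩
      · have hi' : ((i + 1 : ℕ) : ℝ) ≤ ((n + 1 : ℕ) : ℝ) := by
          have := Finset.mem_range.1 hi
          simp only [E] at this
          exact_mod_cast this
        rw [Set.uIcc_of_le hT.le]
        have h3 : h n * (i + 1) ≤ T := by
          rw [← hTn]; push_cast at hi' ⊢; exact mul_le_mul_of_nonneg_left hi' (hh n).le
        have h4 : 0 ≤ h n * (i:ℝ) := by have := hh n; positivity
        have h5 := hlt i
        exact ⟨⟨h4, by simp only [E]; linarith⟩, ⟨by simp only [E]; linarith, h3⟩⟩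
      · intro i _ j _ hij
        simp only [Function.onFun, E]
        rw [Set.uIoc_of_le (hlt i).le, Set.uIoc_of_le (hlt j).le, Set.disjoint_left]
        rintro x ⟨h1, h2⟩ ⟨h3, h4⟩
        apply hij
        have h5 : (i:ℝ) < j + 1 := lt_of_mul_lt_mul_left (h1.trans_le h4) (hh n).le
        have h6 : (j:ℝ) < i + 1 := lt_of_mul_lt_mul_left (h3.trans_le h2) (hh n).le
        have h5 : i < j + 1 := by exact_mod_cast h5
        have h6 : j < i + 1 := by exact_mod_cast h6
        omega
    refine le_trans (le_of_eq ?_) (hle E hE)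
    conv_lhs => rw [← hTn]
    rw [lintegral_cells (h n) (hh n)]
    unfold AE
    refine Finset.sum_congr rfl fun i _ => ?_
    have : ∀ t ∈ Set.Ioc (h n * i) (h n * (i + 1)), ENNReal.ofReal (L (gn n t) + C) =
        ENNReal.ofReal (L ((h n * (i + 1) - h n * i)⁻¹ • (f (h n * (i + 1)) - f (h n * i))) + C) := by
      intro t ht
      have hk : k n t = (i : ℤ) + 1 := by
        simp only [k]
        rw [Int.ceil_eq_iff]
        have := hh n
        constructor
        · rw [lt_div_iff₀ this]; push_cast; linarith [ht.1]
        · rw [div_le_iff₀ this]; push_cast; linarith [ht.2]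
      simp only [gn, hk]
      push_cast
      simp
    rw [setLIntegral_congr_fun measurableSet_Ioc this, setLIntegral_const, Real.volume_Ioc,
      mul_comm]
    simp only [E]
    rw [Real.dist_eq, abs_sub_comm, abs_of_pos (by linarith [hlt i])]
  have hfatou : ∫⁻ t in Set.Ioc 0 T, ENNReal.ofReal (L (g t) + C) ≤ S := by
    calc _ = ∫⁻ t in Set.Ioc 0 T, liminf (fun n => ENNReal.ofReal (L (gn n t) + C)) atTop := by
          refine lintegral_congr_ae ?_
          filter_upwards [hconv] with t ht
          refine (Tendsto.liminf_eq ?_).symm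
          exact (ENNReal.continuous_ofReal.tendsto _).comp
            ((((hLc.tendsto _).comp ht)).add_const C)
      _ ≤ liminf (fun n => ∫⁻ t in Set.Ioc 0 T, ENNReal.ofReal (L (gn n t) + C)) atTop := by
          refine lintegral_liminf_le fun n => ?_
          exact ENNReal.measurable_ofReal.comp ((hLc.measurable.comp (hgnm n)).add_const C)
      _ ≤ S := by
          refine (liminf_le_liminf (Eventually.of_forall hint)).trans ?_
          simp
  obtain ⟨K, hK, hKp⟩ := superlin hr hC hlow (η := 1) one_pos
  have hgi : IntervalIntegrable g volume 0 T := by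
    rw [intervalIntegrable_iff_integrableOn_Ioc_of_le hT.le]
    have h1 : Integrable (fun t => L (g t) + C) (volume.restrict (Set.Ioc 0 T)) := by
      refine ⟨((hLc.measurable.comp hgm).add_const C).aestronglyMeasurable, ?_⟩
      rw [hasFiniteIntegral_iff_ofReal (Eventually.of_forall fun t => h0 _)]
      exact hfatou.trans_lt (lt_of_le_of_ne le_top htop)
    refine Integrable.mono' ((integrable_const K).add h1) hgm.aestronglyMeasurable ?_
    exact Eventually.of_forall fun t => by simpa using hKp (g t)
  refine le_trans (sInf_le ⟨g, hgi, ?_, rfl⟩) hfatou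
  intro s t
  have hsub : Set.uIcc (s:ℝ) t ⊆ Set.uIcc 0 T := by
    rw [Set.uIcc_of_le hT.le]
    exact Set.ordConnected_Icc.uIcc_subset s.2 t.2
  have hgi' : IntervalIntegrable g volume s t := hgi.mono_set hsub
  ext j
  have hacj : AbsolutelyContinuousOnInterval (fun u => f u j) s t := by
    have h1 := hac.mono hsub
    rw [absolutelyContinuousOnInterval_iff] at h1 ⊢
    intro ε hε
    obtain ⟨δ, hδ, hh⟩ := h1 ε hε
    refine ⟨δ, hδ, fun E hE hl => lt_of_le_of_lt (Finset.sum_le_sum fun i _ => ?_) (hh E hE hl)⟩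
    rw [dist_eq_norm, dist_eq_norm]
    exact PiLp.norm_apply_le (f (E.2 i).1 - f (E.2 i).2) j
  have h2 := hacj.integral_deriv_eq_sub
  have h3 : (∫ u in (s:ℝ)..t, g u) j = ∫ u in (s:ℝ)..t, g u j := by
    have := (EuclideanSpace.proj j : Euc d →L[ℝ] ℝ).intervalIntegral_comp_comm hgi'
    exact this.symm
  have h4 : ∫ u in (s:ℝ)..t, g u j = ∫ u in (s:ℝ)..t, deriv (fun u => f u j) u := by
    refine intervalIntegral.integral_congr_ae ?_
    filter_upwards [hdiff] with u hu hum
    have h5 := (hu (hsub (Set.uIoc_subset_uIcc hum))).hasDerivAt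
    have h6 := (EuclideanSpace.proj j : Euc d →L[ℝ] ℝ).hasFDerivAt.comp_hasDerivAt u h5
    exact h6.deriv.symm
  rw [h3, h4, h2]
  simp [hf, evalAt]

lemma action_eq {d : ℕ} {T : ℝ} (hT : 0 < T) (L : Euc d → ℝ) {r C : ℝ} (hr : 1 < r)
    (hC : 0 < C) (hL : ConvexOn ℝ Set.univ L) (hLc : Continuous L)
    (hlow : ∀ p : Euc d, 1 / (r * C) * ‖p‖ ^ r - C ≤ L p) (γ : Traj d T) :
    actionN L C γ = ⨆ E ∈ AbsolutelyContinuousOnInterval.disjWithin 0 T, AE hT.le L C E γ := by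
  have h0 : ∀ p, 0 ≤ L p + C := fun p => by
    have := hlow p
    have h : 0 ≤ 1 / (r * C) * ‖p‖ ^ r := by positivity
    linarith
  refine le_antisymm (action_le_iSup hT L hr hC hLc hlow γ) ?_
  exact iSup₂_le fun E hE => AE_le_action hT.le L C hL hLc h0 E hE γ

lemma action_measurable {d : ℕ} {T : ℝ} (hT : 0 < T) (L : Euc d → ℝ) {r C : ℝ} (hr : 1 < r)
    (hC : 0 < C) (hL : ConvexOn ℝ Set.univ L) (hLc : Continuous L)
    (hlow : ∀ p : Euc d, 1 / (r * C) * ‖p‖ ^ r - C ≤ L p) :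
    Measurable (actionN (d := d) (T := T) L C) := by
  have : actionN (d := d) (T := T) L C = fun γ =>
      ⨆ E ∈ AbsolutelyContinuousOnInterval.disjWithin 0 T, AE hT.le L C E γ :=
    funext (action_eq hT L hr hC hL hLc hlow)
  rw [this]
  refine LowerSemicontinuous.measurable ?_
  exact lowerSemicontinuous_biSup fun E _ => (AE_continuous hT.le L C hLc E).lowerSemicontinuous

lemma action_jensen {d : ℕ} {T : ℝ} (hT : 0 < T) (L : Euc d → ℝ) {r C : ℝ} (hr : 1 < r)
    (hC : 0 < C) (hL : ConvexOn ℝ Set.univ L) (hLc : Continuous L)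
    (hlow : ∀ p : Euc d, 1 / (r * C) * ‖p‖ ^ r - C ≤ L p)
    {H : Type*} [NormedAddCommGroup H] [NormedSpace ℝ H] [CompleteSpace H]
    [MeasurableSpace H] [BorelSpace H]
    (ι : H →L[ℝ] Traj d T) (ν : Measure H) [IsProbabilityMeasure ν]
    (hν : Integrable (fun y => y) ν) (c : Euc d) :
    actionN L C (ι (∫ y, y ∂ν) + ContinuousMap.const _ c) ≤ ∫⁻ y, actionN L C (ι y) ∂ν := by
  have h0 : ∀ p, 0 ≤ L p + C := fun p => by
    have := hlow p
    have h : 0 ≤ 1 / (r * C) * ‖p‖ ^ r := by positivity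
    linarith
  have htr : actionN L C (ι (∫ y, y ∂ν) + ContinuousMap.const _ c) =
      actionN L C (ι (∫ y, y ∂ν)) := by
    unfold actionN; simp
  rw [htr, action_eq hT L hr hC hL hLc hlow]
  refine iSup₂_le fun E hE => ?_
  refine (AE_jensen hT.le L C hL hLc h0 E ι ν hν).trans ?_
  exact lintegral_mono fun y => AE_le_action hT.le L C hL hLc h0 E hE _

lemma lintegral_unif {X : Type*} [MeasurableSpace X] (N : ℕ) (x : Fin N → X) (f : X → ℝ≥0∞)
    (hf : Measurable f) :
    ∫⁻ a, f a ∂((N : ℝ≥0∞)⁻¹ • ∑ i, Measure.dirac (x i)) = (N : ℝ≥0∞)⁻¹ * ∑ i, f (x i) := by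
  rw [lintegral_smul_measure, lintegral_finsetSum_measure, smul_eq_mul]
  simp [lintegral_dirac' _ hf]

lemma unif_prob {X : Type*} [MeasurableSpace X] (N : ℕ) (hN : N ≠ 0) (ν : Fin N → Measure X)
    (hν : ∀ i, IsProbabilityMeasure (ν i)) :
    IsProbabilityMeasure ((N : ℝ≥0∞)⁻¹ • ∑ i, ν i) := by
  constructor
  simp only [Measure.smul_apply, Measure.finsetSum_apply, measure_univ, Finset.sum_const,
    Finset.card_univ, Fintype.card_fin, smul_eq_mul, nsmul_eq_mul, mul_one]
  exact ENNReal.inv_mul_cancel (by simpa using hN) (by simp)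

lemma disint {X Y : Type*} [MeasurableSpace X] [MeasurableSpace Y] [StandardBorelSpace Y]
    [Nonempty Y] (N : ℕ) (hN : N ≠ 0) (x : Fin N → X) (π : Measure (X × Y))
    (hfst : π.map Prod.fst = (N : ℝ≥0∞)⁻¹ • ∑ i, Measure.dirac (x i)) :
    ∃ R : Fin N → Measure Y, (∀ i, IsProbabilityMeasure (R i)) ∧
      ∀ f : X × Y → ℝ≥0∞, Measurable f →
        ∫⁻ p, f p ∂π = (N : ℝ≥0∞)⁻¹ * ∑ i, ∫⁻ y, f (x i, y) ∂(R i) := by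
  have hp := unif_prob N hN (fun i => Measure.dirac (x i)) (fun i => inferInstance)
  have hπ : IsFiniteMeasure π := by
    constructor
    have : π.map Prod.fst univ = 1 := by rw [hfst]; exact hp.1
    rw [Measure.map_apply measurable_fst MeasurableSet.univ] at this
    simp at this
    simp [this]
  refine ⟨fun i => π.condKernel (x i), fun i => inferInstance, fun f hf => ?_⟩
  conv_lhs => rw [← π.disintegrate π.condKernel]
  rw [Measure.lintegral_compProd hf]
  have : π.fst = (N : ℝ≥0∞)⁻¹ • ∑ i, Measure.dirac (x i) := hfst
  rw [this, lintegral_unif _ _ _ (Measurable.lintegral_kernel_prod_right' hf)]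

lemma disint_snd {X Y : Type*} [MeasurableSpace X] [MeasurableSpace Y]
    (N : ℕ) (x : Fin N → X) (π : Measure (X × Y)) (R : Fin N → Measure Y)
    (hR : ∀ f : X × Y → ℝ≥0∞, Measurable f →
        ∫⁻ p, f p ∂π = (N : ℝ≥0∞)⁻¹ * ∑ i, ∫⁻ y, f (x i, y) ∂(R i)) :
    π.map Prod.snd = (N : ℝ≥0∞)⁻¹ • ∑ i, R i := by
  ext s hs
  rw [Measure.map_apply measurable_snd hs, ← lintegral_indicator_one (measurable_snd hs),
    hR _ (measurable_one.indicator (measurable_snd hs))]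
  simp only [Measure.smul_apply, Measure.finsetSum_apply, smul_eq_mul]
  congr 1
  refine Finset.sum_congr rfl fun i _ => ?_
  rw [← lintegral_indicator_one hs]
  rfl

lemma mean_le {H : Type*} [NormedAddCommGroup H] [InnerProductSpace ℝ H] [CompleteSpace H]
    [SecondCountableTopology H] [MeasurableSpace H] [BorelSpace H] (ν : Measure H)
    [IsProbabilityMeasure ν] (x : H)
    (hfin : ∫⁻ y, ENNReal.ofReal (dist x y ^ 2) ∂ν ≠ ⊤) :
    Integrable (fun y => y) ν ∧ ∫⁻ y, ENNReal.ofReal (dist (∫ y, y ∂ν) y ^ 2) ∂ν ≤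
      ∫⁻ y, ENNReal.ofReal (dist x y ^ 2) ∂ν := by
  have hsm : StronglyMeasurable (fun y : H => y) := stronglyMeasurable_id
  have h2 : MemLp (fun y => y - x) 2 ν := by
    refine (memLp_two_iff_integrable_sq_norm (f := fun y => y - x)
      (hsm.sub stronglyMeasurable_const).aestronglyMeasurable).2 ?_
    refine ⟨by fun_prop, ?_⟩
    rw [hasFiniteIntegral_iff_ofReal (Eventually.of_forall fun x => by positivity)]
    simp_rw [dist_eq_norm, norm_sub_rev x] at hfin
    exact lt_of_le_of_ne le_top hfin
  have hi : Integrable (fun y => y) ν := by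
    have := (h2.integrable (by norm_num)).add (integrable_const x)
    refine this.congr (Eventually.of_forall fun y => by simp)
  refine ⟨hi, ?_⟩
  set m := ∫ y, y ∂ν with hm
  have h3 : MemLp (fun y => y - m) 2 ν := by
    have := h2.add (memLp_const (x - m))
    refine this.ae_eq (Eventually.of_forall fun y => by simp)
  have i2 : Integrable (fun y => ‖y - x‖ ^ 2) ν := h2.integrable_norm_pow (by norm_num)
  have i3 : Integrable (fun y => ‖y - m‖ ^ 2) ν := h3.integrable_norm_pow (by norm_num)
  have e : ∫ y, ‖y - x‖ ^ 2 ∂ν = ∫ y, ‖y - m‖ ^ 2 ∂ν + ‖m - x‖ ^ 2 := by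
    have i4 : Integrable (fun y => y - m) ν := hi.sub (integrable_const m)
    have i5 : Integrable (fun y => 2 * inner ℝ (m - x) (y - m)) ν :=
      (i4.const_inner (m - x)).const_mul 2
    have h6 : ∀ y, ‖y - x‖ ^ 2 = (‖y - m‖ ^ 2 + 2 * inner ℝ (m - x) (y - m)) + ‖m - x‖ ^ 2 := by
      intro y
      have : y - x = (y - m) + (m - x) := by abel
      rw [this, norm_add_sq_real, real_inner_comm]
    have i35 : Integrable (fun y => ‖y - m‖ ^ 2 + 2 * inner ℝ (m - x) (y - m)) ν := i3.add i5
    rw [integral_congr_ae (Eventually.of_forall h6)]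
    rw [integral_add i35 (integrable_const _), integral_add i3 i5, integral_const_mul,
      integral_inner i4, integral_sub hi (integrable_const m)]
    simp [← hm]
  simp_rw [dist_eq_norm]
  have a1 := ofReal_integral_eq_lintegral_ofReal i2 (Eventually.of_forall fun y => by positivity)
  have a2 := ofReal_integral_eq_lintegral_ofReal i3 (Eventually.of_forall fun y => by positivity)
  simp_rw [norm_sub_rev _ m, norm_sub_rev _ x] at a1 a2
  simp_rw [norm_sub_rev _ m, norm_sub_rev _ x] at e
  rw [← a1, ← a2]
  refine ENNReal.ofReal_le_ofReal ?_
  rw [e]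
  have := sq_nonneg ‖x - m‖
  linarith [sq_nonneg ‖m - x‖]

lemma birkhoff_choice (N : ℕ) (M : Matrix (Fin N) (Fin N) ℝ) (hM : M ∈ doublyStochastic ℝ (Fin N))
    (c : Fin N → Fin N → ℝ) :
    ∃ σ : Equiv.Perm (Fin N), ∑ i, c i (σ i) ≤ ∑ i, ∑ j, M i j * c i j := by
  obtain ⟨w, hw0, hw1, hw⟩ := exists_eq_sum_perm_of_mem_doublyStochastic hM
  obtain ⟨σ, hσ⟩ := Finite.exists_min (fun σ : Equiv.Perm (Fin N) => ∑ i, c i (σ i))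
  refine ⟨σ, ?_⟩
  have h1 : ∑ i, ∑ j, M i j * c i j = ∑ σ, w σ * ∑ i, c i (σ i) := by
    rw [← hw]
    simp only [Matrix.sum_apply, Matrix.smul_apply, smul_eq_mul, Finset.sum_mul]
    calc _ = ∑ i, ∑ τ, ∑ j, w τ * (τ.permMatrix ℝ) i j * c i j :=
          Finset.sum_congr rfl fun i _ => Finset.sum_comm
      _ = ∑ τ, ∑ i, ∑ j, w τ * (τ.permMatrix ℝ) i j * c i j := Finset.sum_comm
      _ = _ := by
          refine Finset.sum_congr rfl fun τ _ => ?_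
          rw [Finset.mul_sum]
          refine Finset.sum_congr rfl fun i _ => ?_
          simp [Equiv.Perm.permMatrix, PEquiv.toMatrix_apply]
  rw [h1]
  calc ∑ i, c i (σ i) = ∑ τ, w τ * ∑ i, c i (σ i) := by rw [← Finset.sum_mul, hw1, one_mul]
    _ ≤ _ := Finset.sum_le_sum fun τ _ => mul_le_mul_of_nonneg_left (hσ τ) (hw0 τ)

lemma dist_sq_le {X : Type*} [PseudoMetricSpace X] (a b z : X) :
    ENNReal.ofReal (dist a b ^ 2) ≤
      2 * (ENNReal.ofReal (dist a z ^ 2) + ENNReal.ofReal (dist b z ^ 2)) := by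
  have e : (2 : ℝ≥0∞) = ENNReal.ofReal 2 := by simp
  rw [← ENNReal.ofReal_add (by positivity) (by positivity), e, ← ENNReal.ofReal_mul (by positivity)]
  refine ENNReal.ofReal_le_ofReal ?_
  have := dist_triangle_right a b z
  have h0 : 0 ≤ dist a b := dist_nonneg
  nlinarith [sq_nonneg (dist a z - dist b z)]

lemma assign {X : Type*} [PseudoMetricSpace X] [SecondCountableTopology X] [MeasurableSpace X]
    [BorelSpace X] (N : ℕ) (U S : Fin N → Measure X)
    (hU : ∀ i, IsProbabilityMeasure (U i)) (hS : ∀ i, IsProbabilityMeasure (S i))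
    (hUS : ∑ i, U i = ∑ j, S j) (x y : Fin N → X) :
    ∃ σ : Equiv.Perm (Fin N), ∑ i, ENNReal.ofReal (dist (x i) (y (σ i)) ^ 2) ≤
      2 * (∑ i, ∫⁻ z, ENNReal.ofReal (dist (x i) z ^ 2) ∂(U i) +
        ∑ j, ∫⁻ z, ENNReal.ofReal (dist (y j) z ^ 2) ∂(S j)) := by
  set μ := ∑ i, U i with hμ
  have hμf : IsFiniteMeasure μ := by
    rw [hμ]; infer_instance
  have hle : ∀ j, S j ≤ μ := fun j => by
    rw [hUS]; exact Finset.single_le_sum (f := S) (fun _ _ => Measure.zero_le _) (Finset.mem_univ j)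
  have hleU : ∀ j, U j ≤ μ := fun j => by
    rw [hμ]; exact Finset.single_le_sum (f := U) (fun _ _ => Measure.zero_le _) (Finset.mem_univ j)
  set s : Fin N → X → ℝ≥0∞ := fun j => (S j).rnDeriv μ with hs
  have hsm : ∀ j, Measurable (s j) := fun j => Measure.measurable_rnDeriv _ _
  have hwd : ∀ j, μ.withDensity (s j) = S j := fun j =>
    Measure.withDensity_rnDeriv_eq _ _ (Measure.absolutelyContinuous_of_le (hle j))
  have hsum : ∀ᵐ z ∂μ, ∑ j, s j z = 1 := by
    have h1 : μ.withDensity (fun z => ∑ j, s j z) = μ.withDensity 1 := by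
      rw [withDensity_one]
      ext A hA
      rw [withDensity_apply _ hA, lintegral_finsetSum _ (fun j _ => hsm j)]
      conv_rhs => rw [hUS]
      rw [Measure.finsetSum_apply]
      refine Finset.sum_congr rfl fun j _ => ?_
      conv_rhs => rw [← hwd j]
      rw [withDensity_apply _ hA]
    have hm : Measurable (fun z => ∑ j, s j z) := Finset.measurable_sum _ fun j _ => hsm j
    have := (withDensity_eq_iff_of_sigmaFinite (μ := μ) hm.aemeasurable
      measurable_one.aemeasurable).1 h1
    filter_upwards [this] with z hz using hz
  have hsumU : ∀ i, ∀ᵐ z ∂(U i), ∑ j, s j z = 1 := fun i =>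
    (Measure.absolutelyContinuous_of_le (hleU i)).ae_le hsum
  have hlintS : ∀ j (f : X → ℝ≥0∞), Measurable f →
      ∑ i, ∫⁻ z, s j z * f z ∂(U i) = ∫⁻ z, f z ∂(S j) := by
    intro j f hf
    conv_rhs => rw [← hwd j]
    rw [lintegral_withDensity_eq_lintegral_mul _ (hsm j) hf, hμ, lintegral_finsetSum_measure]
    rfl
  set M : Fin N → Fin N → ℝ≥0∞ := fun i j => ∫⁻ z, s j z ∂(U i) with hM
  have hrow : ∀ i, ∑ j, M i j = 1 := by
    intro i
    simp only [hM]
    rw [← lintegral_finsetSum _ (fun j _ => hsm j), lintegral_congr_ae (hsumU i)]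
    simp
  have hcol : ∀ j, ∑ i, M i j = 1 := by
    intro j
    have := hlintS j 1 measurable_one
    simpa using this
  have hMtop : ∀ i j, M i j ≠ ⊤ := fun i j => by
    have : M i j ≤ 1 := by
      rw [← hrow i]; exact Finset.single_le_sum (f := M i) (fun _ _ => zero_le) (Finset.mem_univ j)
    exact ne_top_of_le_ne_top ENNReal.one_ne_top this
  obtain ⟨σ, hσ⟩ := birkhoff_choice N (Matrix.of fun i j => (M i j).toReal) (by
      rw [mem_doublyStochastic_iff_sum]
      refine ⟨fun i j => ENNReal.toReal_nonneg, fun i => ?_, fun j => ?_⟩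
      · simp only [Matrix.of_apply]
        rw [← ENNReal.toReal_sum (fun j _ => hMtop i j), hrow]; simp
      · simp only [Matrix.of_apply]
        rw [← ENNReal.toReal_sum (fun i _ => hMtop i j), hcol]; simp)
    (fun i j => dist (x i) (y j) ^ 2)
  refine ⟨σ, ?_⟩
  have hdm : ∀ a : X, Measurable fun z => ENNReal.ofReal (dist a z ^ 2) := fun a => by fun_prop
  calc ∑ i, ENNReal.ofReal (dist (x i) (y (σ i)) ^ 2)
      = ENNReal.ofReal (∑ i, dist (x i) (y (σ i)) ^ 2) :=
        (ENNReal.ofReal_sum_of_nonneg fun i _ => by positivity).symm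
    _ ≤ ENNReal.ofReal (∑ i, ∑ j, (M i j).toReal * dist (x i) (y j) ^ 2) :=
        ENNReal.ofReal_le_ofReal hσ
    _ = ∑ i, ∑ j, M i j * ENNReal.ofReal (dist (x i) (y j) ^ 2) := by
        rw [ENNReal.ofReal_sum_of_nonneg fun i _ => Finset.sum_nonneg fun j _ => by positivity]
        refine Finset.sum_congr rfl fun i _ => ?_
        rw [ENNReal.ofReal_sum_of_nonneg fun j _ => by positivity]
        refine Finset.sum_congr rfl fun j _ => ?_
        rw [ENNReal.ofReal_mul ENNReal.toReal_nonneg, ENNReal.ofReal_toReal (hMtop i j)]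
    _ ≤ ∑ i, ∑ j, ∫⁻ z, 2 * (s j z * ENNReal.ofReal (dist (x i) z ^ 2) +
          s j z * ENNReal.ofReal (dist (y j) z ^ 2)) ∂(U i) := by
        refine Finset.sum_le_sum fun i _ => Finset.sum_le_sum fun j _ => ?_
        simp only [hM]
        rw [← lintegral_mul_const _ (hsm j)]
        refine lintegral_mono fun z => ?_
        calc _ ≤ s j z * (2 * (ENNReal.ofReal (dist (x i) z ^ 2) +
              ENNReal.ofReal (dist (y j) z ^ 2))) := by gcongr; exact dist_sq_le _ _ _
          _ = _ := by ring
    _ = 2 * (∑ i, ∑ j, ∫⁻ z, s j z * ENNReal.ofReal (dist (x i) z ^ 2) ∂(U i) +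
          ∑ i, ∑ j, ∫⁻ z, s j z * ENNReal.ofReal (dist (y j) z ^ 2) ∂(U i)) := by
        simp_rw [← Finset.sum_add_distrib, Finset.mul_sum]
        refine Finset.sum_congr rfl fun i _ => Finset.sum_congr rfl fun j _ => ?_
        have m1 : ∀ a : X, Measurable fun z => s j z * ENNReal.ofReal (dist a z ^ 2) :=
          fun a => (hsm j).mul (hdm a)
        have m2 : Measurable fun z => s j z * ENNReal.ofReal (dist (x i) z ^ 2) +
          s j z * ENNReal.ofReal (dist (y j) z ^ 2) := (m1 _).add (m1 _)
        rw [lintegral_const_mul _ m2, lintegral_add_left (m1 _)]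
    _ = _ := by
        congr 2
        · refine Finset.sum_congr rfl fun i _ => ?_
          rw [← lintegral_finsetSum (f := fun j z => s j z * ENNReal.ofReal (dist (x i) z ^ 2)) _
            (fun j _ => (hsm j).mul (hdm _))]
          refine lintegral_congr_ae ?_
          filter_upwards [hsumU i] with z hz
          rw [← Finset.sum_mul, hz, one_mul]
        · rw [Finset.sum_comm]
          exact Finset.sum_congr rfl fun j _ => hlintS j _ (hdm _)

lemma unif_map {X Y : Type*} [MeasurableSpace X] [MeasurableSpace Y] (N : ℕ)
    (ν : Fin N → Measure X) (f : X → Y) (hf : Measurable f) :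
    ((N : ℝ≥0∞)⁻¹ • ∑ i, ν i).map f = (N : ℝ≥0∞)⁻¹ • ∑ i, (ν i).map f := by
  ext s hs
  rw [Measure.map_apply hf hs]
  simp only [Measure.smul_apply, Measure.finsetSum_apply, smul_eq_mul]
  congr 1
  exact Finset.sum_congr rfl fun i _ => (Measure.map_apply hf hs).symm

lemma build {d : ℕ} {T : ℝ} (hT : 0 < T) (L : Euc d → ℝ) {r C : ℝ} (hr : 1 < r)
    (hC : 0 < C) (hL : ConvexOn ℝ Set.univ L) (hLc : Continuous L)
    (hlow : ∀ p : Euc d, 1 / (r * C) * ‖p‖ ^ r - C ≤ L p)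
    {H : Type*} [NormedAddCommGroup H] [InnerProductSpace ℝ H] [CompleteSpace H]
    [SecondCountableTopology H] [MeasurableSpace H] [BorelSpace H]
    (ι : H →L[ℝ] Traj d T) (R : Measure H) (N : ℕ) (hN : N ≠ 0)
    (P : Measure H) (hP : IsUnifDiscrete N P) (π : Measure (H × H))
    (hπ1 : π.map Prod.fst = P) (hπ2 : π.map Prod.snd = R)
    (hfin : ∫⁻ p, ENNReal.ofReal (dist p.1 p.2 ^ 2) ∂π ≠ ⊤)
    (μN : Measure (Euc d)) (hμN : IsUnifDiscrete N μN) (π' : Measure (Euc d × Euc d))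
    (hπ1' : π'.map Prod.fst = μN)
    (hπ2' : π'.map Prod.snd = (R.map ι).map (evalAt hT.le 0)) :
    ∃ (Q : Measure (Traj d T)) (Pl : Measure (Traj d T × Traj d T)),
      (IsProbabilityMeasure Q ∧ IsProbabilityMeasure Pl ∧ Pl.map Prod.fst = Q ∧
        Pl.map Prod.snd = R.map ι) ∧
      IsUnifDiscrete N Q ∧ Q.map (evalAt hT.le 0) = μN ∧
      ∫⁻ γ, actionN L C γ ∂Q ≤ ∫⁻ γ, actionN L C γ ∂(R.map ι) ∧
      ∫⁻ p, ENNReal.ofReal (dist p.1 p.2 ^ 2) ∂Pl ≤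
        4 * ∫⁻ p, ENNReal.ofReal (dist p.1 p.2 ^ 2) ∂π' +
        6 * ENNReal.ofReal (‖ι‖ ^ 2) * ∫⁻ p, ENNReal.ofReal (dist p.1 p.2 ^ 2) ∂π := by
  obtain ⟨x, rfl⟩ := hP
  obtain ⟨y, rfl⟩ := hμN
  have hN' : ((N : ℝ≥0∞)⁻¹) ≠ 0 := by simp
  have hNt : ((N : ℝ≥0∞)⁻¹) ≠ ⊤ := by simpa using hN
  obtain ⟨Ri, hRp, hRi⟩ := disint N hN x π hπ1
  obtain ⟨S, hSp, hS⟩ := disint N hN y π' hπ1'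
  have hR2 := disint_snd N x π Ri hRi
  have hS2 := disint_snd N y π' S hS
  rw [hπ2] at hR2
  rw [hπ2'] at hS2
  have hιm : Measurable ι := ι.continuous.measurable
  have hem : ∀ t, Measurable (evalAt (d := d) hT.le t) := fun t =>
    (continuous_evalAt hT.le t).measurable
  have hcπ := hRi (fun p => ENNReal.ofReal (dist p.1 p.2 ^ 2)) (by fun_prop)
  have hcπ' := hS (fun p => ENNReal.ofReal (dist p.1 p.2 ^ 2)) (by fun_prop)
  simp only at hcπ hcπ'
  have hfi : ∀ i, ∫⁻ z, ENNReal.ofReal (dist (x i) z ^ 2) ∂(Ri i) ≠ ⊤ := by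
    rw [hcπ] at hfin
    intro i
    have h1 : ∑ i, ∫⁻ z, ENNReal.ofReal (dist (x i) z ^ 2) ∂(Ri i) ≠ ⊤ := by
      intro h
      rw [h] at hfin
      exact hfin (ENNReal.mul_top hN')
    exact (ENNReal.sum_ne_top.1 h1) i (Finset.mem_univ i)
  have hmean := fun i => mean_le (Ri i) (x i) (hfi i)
  set m : Fin N → H := fun i => ∫ z, z ∂(Ri i) with hm
  set e0 : H → Euc d := fun z => evalAt hT.le 0 (ι z) with he0
  have he0m : Measurable e0 := (hem 0).comp hιm
  set U : Fin N → Measure (Euc d) := fun i => (Ri i).map e0 with hU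
  have hUp : ∀ i, IsProbabilityMeasure (U i) := fun i =>
    Measure.isProbabilityMeasure_map he0m.aemeasurable
  have hUS : ∑ i, U i = ∑ j, S j := by
    have h1 : (N : ℝ≥0∞)⁻¹ • ∑ i, U i = (N : ℝ≥0∞)⁻¹ • ∑ j, S j := by
      rw [← hS2, Measure.map_map (hem 0) hιm, hR2, unif_map _ _ _ ((hem 0).comp hιm)]
      rfl
    have h2 := congrArg (fun ν => (N : ℝ≥0∞) • ν) h1
    simp only [smul_smul] at h2
    rw [ENNReal.mul_inv_cancel (by simpa using hN) (by simp)] at h2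
    simpa using h2
  obtain ⟨σ, hσ⟩ := assign N U S hUp hSp hUS (fun i => e0 (m i)) y
  let g : Fin N → Traj d T := fun i => ι (m i) + ContinuousMap.const _ (y (σ i) - e0 (m i))
  have hg0 : ∀ i, evalAt hT.le 0 (g i) = y (σ i) := by
    intro i
    simp [g, he0, evalAt]
  let κ2 : ℝ≥0∞ := ENNReal.ofReal (‖ι‖ ^ 2)
  have hgdist : ∀ i z, ENNReal.ofReal (dist (g i) (ι z) ^ 2) ≤
      2 * (ENNReal.ofReal (dist (e0 (m i)) (y (σ i)) ^ 2) +
        κ2 * ENNReal.ofReal (dist (m i) z ^ 2)) := by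
    intro i z
    refine (dist_sq_le (g i) (ι z) (ι (m i))).trans ?_
    gcongr
    · rw [dist_eq_norm]
      have : g i - ι (m i) = ContinuousMap.const _ (y (σ i) - e0 (m i)) := by
        simp only [g]; abel
      rw [this, dist_comm, dist_eq_norm]
      rw [ContinuousMap.norm_le _ (norm_nonneg _)]
      intro t; simp
    · simp only [κ2]
      rw [← ENNReal.ofReal_mul (by positivity), ← mul_pow]
      gcongr
      rw [dist_comm (m i), dist_eq_norm, ← map_sub, dist_eq_norm]
      exact ι.le_opNorm _
  have he0dist : ∀ i z, ENNReal.ofReal (dist (e0 (m i)) (e0 z) ^ 2) ≤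
      κ2 * ENNReal.ofReal (dist (m i) z ^ 2) := by
    intro i z
    simp only [κ2]
    rw [← ENNReal.ofReal_mul (by positivity), ← mul_pow]
    gcongr
    calc dist (e0 (m i)) (e0 z) ≤ dist (ι (m i)) (ι z) := ContinuousMap.dist_apply_le_dist _
      _ ≤ _ := by
        rw [dist_eq_norm, ← map_sub, dist_eq_norm]
        exact ι.le_opNorm _
  set b : ℝ≥0∞ := ∑ i, ∫⁻ z, ENNReal.ofReal (dist (m i) z ^ 2) ∂(Ri i) with hb
  have hba : b ≤ ∑ i, ∫⁻ z, ENNReal.ofReal (dist (x i) z ^ 2) ∂(Ri i) :=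
    Finset.sum_le_sum fun i _ => (hmean i).2
  have hdm : ∀ i, Measurable fun z => ENNReal.ofReal (dist (m i) z ^ 2) := fun i => by fun_prop
  have hUb : ∑ i, ∫⁻ z, ENNReal.ofReal (dist (e0 (m i)) z ^ 2) ∂(U i) ≤ κ2 * b := by
    rw [hb, Finset.mul_sum]
    refine Finset.sum_le_sum fun i _ => ?_
    rw [lintegral_map (by fun_prop) he0m, ← lintegral_const_mul _ (hdm i)]
    exact lintegral_mono fun z => he0dist i z
  let J : Fin N → H → Traj d T × Traj d T := fun i z => (g i, ι z)
  have hJ : ∀ i, Measurable (J i) := fun i => measurable_const.prodMk hιm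
  let Q : Measure (Traj d T) := (N : ℝ≥0∞)⁻¹ • ∑ i, Measure.dirac (g i)
  let Pl : Measure (Traj d T × Traj d T) := (N : ℝ≥0∞)⁻¹ • ∑ i, (Ri i).map (J i)
  refine ⟨Q, Pl, ⟨unif_prob N hN _ fun i => inferInstance, unif_prob N hN _ fun i =>
    Measure.isProbabilityMeasure_map (hJ i).aemeasurable, ?_, ?_⟩, ⟨g, rfl⟩, ?_, ?_, ?_⟩
  · simp only [Pl, Q]
    rw [unif_map _ _ _ measurable_fst]
    congr 1
    refine Finset.sum_congr rfl fun i _ => ?_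
    rw [Measure.map_map measurable_fst (hJ i)]
    have : (Prod.fst ∘ J i) = fun _ => g i := rfl
    rw [this, Measure.map_const, measure_univ, one_smul]
  · simp only [Pl]
    rw [unif_map _ _ _ measurable_snd, hR2, unif_map _ _ _ hιm]
    congr 1
    refine Finset.sum_congr rfl fun i _ => ?_
    rw [Measure.map_map measurable_snd (hJ i)]
    rfl
  · simp only [Q]
    rw [unif_map _ _ _ (hem 0)]
    congr 1
    simp_rw [Measure.map_dirac' (hem 0), hg0]
    exact Equiv.sum_comp σ (fun j => Measure.dirac (y j))
  · have ham := action_measurable hT L hr hC hL hLc hlow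
    simp only [Q]
    rw [lintegral_unif _ _ _ ham, lintegral_map ham hιm, hR2, lintegral_smul_measure,
      lintegral_finsetSum_measure, smul_eq_mul]
    gcongr with i
    exact action_jensen hT L hr hC hL hLc hlow ι (Ri i) (hmean i).1 _
  · simp only [Pl]
    rw [lintegral_smul_measure, lintegral_finsetSum_measure, smul_eq_mul, hcπ, hcπ']
    set a : ℝ≥0∞ := ∑ i, ∫⁻ z, ENNReal.ofReal (dist (x i) z ^ 2) ∂(Ri i) with ha
    set s : ℝ≥0∞ := ∑ i, ∫⁻ z, ENNReal.ofReal (dist (y i) z ^ 2) ∂(S i) with hs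
    have hmd : Measurable fun p : Traj d T × Traj d T => ENNReal.ofReal (dist p.1 p.2 ^ 2) := by
      fun_prop
    have h1 : ∑ i, ∫⁻ p, ENNReal.ofReal (dist p.1 p.2 ^ 2) ∂((Ri i).map (J i)) ≤
        4 * s + 6 * κ2 * a := by
      calc _ ≤ ∑ i, (2 * (ENNReal.ofReal (dist (e0 (m i)) (y (σ i)) ^ 2) +
            κ2 * ∫⁻ z, ENNReal.ofReal (dist (m i) z ^ 2) ∂(Ri i))) := by
            refine Finset.sum_le_sum fun i _ => ?_
            rw [lintegral_map hmd (hJ i)]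
            refine (lintegral_mono fun z => hgdist i z).trans ?_
            rw [lintegral_const_mul _ (by fun_prop), lintegral_add_left measurable_const,
              lintegral_const_mul _ (hdm i)]
            simp
        _ = 2 * (∑ i, ENNReal.ofReal (dist (e0 (m i)) (y (σ i)) ^ 2) + κ2 * b) := by
            rw [← Finset.mul_sum, Finset.sum_add_distrib, hb, ← Finset.mul_sum]
        _ ≤ 2 * (2 * (κ2 * a + s) + κ2 * a) := by
            gcongr
            refine hσ.trans ?_
            gcongr
            exact hUb.trans (by gcongr)
        _ = _ := by ring
    calc _ ≤ (N : ℝ≥0∞)⁻¹ * (4 * s + 6 * κ2 * a) := by gcongr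
      _ = _ := by simp only [κ2]; ring

lemma narrow_of_coupling {X : Type*} [PseudoMetricSpace X] [SecondCountableTopology X]
    [MeasurableSpace X] [BorelSpace X] (Q : ℕ → Measure X) (Q' : Measure X)
    (hQ : ∀ n, IsProbabilityMeasure (Q n)) (hQ' : IsProbabilityMeasure Q')
    (Pl : ℕ → Measure (X × X)) (hPl : ∀ n, IsProbabilityMeasure (Pl n))
    (h1 : ∀ n, (Pl n).map Prod.fst = Q n) (h2 : ∀ n, (Pl n).map Prod.snd = Q')
    (hlim : Tendsto (fun n => ∫⁻ p, ENNReal.ofReal (dist p.1 p.2 ^ 2) ∂(Pl n)) atTop (𝓝 0)) :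
    NarrowTendsto Q Q' := by
  let q : ℕ → ProbabilityMeasure X := fun n => ⟨Q n, hQ n⟩
  let q' : ProbabilityMeasure X := ⟨Q', hQ'⟩
  have key : Tendsto q atTop (𝓝 q') := by
    rw [tendsto_iff_forall_lipschitz_integral_tendsto]
    rintro f ⟨B, hB⟩ ⟨K, hK⟩
    change Tendsto (fun n => ∫ x, f x ∂(Q n)) atTop (𝓝 (∫ x, f x ∂Q'))
    have hfc : Continuous f := hK.continuous
    have hfb : ∀ (ν : Measure (X × X)) [IsProbabilityMeasure ν] (φ : X × X → X), Measurable φ →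
        Integrable (fun p => f (φ p)) ν := by
      intro ν _ φ hφ
      have hne : Nonempty (X × X) := by
        by_contra h
        rw [not_nonempty_iff] at h
        have := measure_univ (μ := ν)
        rw [Set.univ_eq_empty_iff.2 h] at this
        simp at this
      obtain ⟨p0⟩ := hne
      refine Integrable.mono' (integrable_const (|f p0.1| + B))
        (hfc.measurable.comp hφ).aestronglyMeasurable (Eventually.of_forall fun p => ?_)
      have := hB (φ p) p0.1
      rw [Real.dist_eq] at this
      rw [Real.norm_eq_abs]
      have h3 := abs_add_le (f (φ p) - f p0.1) (f p0.1)
      simp at h3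
      linarith
    rw [tendsto_iff_dist_tendsto_zero]
    have hle : ∀ n (δ : ℝ), 0 < δ → ENNReal.ofReal (dist (∫ x, f x ∂(Q n)) (∫ x, f x ∂Q')) ≤
        K * (ENNReal.ofReal δ + ENNReal.ofReal δ⁻¹ *
          ∫⁻ p, ENNReal.ofReal (dist p.1 p.2 ^ 2) ∂(Pl n)) := by
      intro n δ hδ
      have := hPl n
      rw [← h1 n, ← h2 n, integral_map measurable_fst.aemeasurable hfc.aestronglyMeasurable,
        integral_map measurable_snd.aemeasurable hfc.aestronglyMeasurable, dist_eq_norm,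
        ← integral_sub (hfb _ _ measurable_fst) (hfb _ _ measurable_snd), ofReal_norm]
      refine (enorm_integral_le_lintegral_enorm _).trans ?_
      have hm1 : Measurable fun p : X × X => ENNReal.ofReal (dist p.1 p.2 ^ 2) := by fun_prop
      calc _ ≤ ∫⁻ p, K * (ENNReal.ofReal δ + ENNReal.ofReal δ⁻¹ *
            ENNReal.ofReal (dist p.1 p.2 ^ 2)) ∂(Pl n) := by
            refine lintegral_mono fun p => ?_
            have h3 := hK.dist_le_mul p.1 p.2
            have h4 : dist p.1 p.2 ≤ δ + δ⁻¹ * dist p.1 p.2 ^ 2 := by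
              have h5 : 0 ≤ dist p.1 p.2 := dist_nonneg
              have h6 : δ * (δ + δ⁻¹ * dist p.1 p.2 ^ 2) = δ ^ 2 + dist p.1 p.2 ^ 2 := by
                field_simp
              refine le_of_mul_le_mul_left ?_ hδ
              rw [h6]
              nlinarith [sq_nonneg (δ - dist p.1 p.2), sq_nonneg δ, sq_nonneg (dist p.1 p.2)]
            have e : (K : ℝ≥0∞) = ENNReal.ofReal K := by simp
            rw [← ofReal_norm, ← dist_eq_norm, ← ENNReal.ofReal_mul (by positivity),
              ← ENNReal.ofReal_add (by positivity) (by positivity), e,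
              ← ENNReal.ofReal_mul (by positivity)]
            refine ENNReal.ofReal_le_ofReal (h3.trans ?_)
            gcongr
        _ = _ := by
            rw [lintegral_const_mul _ (by fun_prop), lintegral_add_left measurable_const,
              lintegral_const_mul _ hm1]
            simp
    have hE : Tendsto (fun n => ENNReal.ofReal (dist (∫ x, f x ∂(Q n)) (∫ x, f x ∂Q'))) atTop
        (𝓝 0) := by
      rw [ENNReal.tendsto_nhds_zero]
      intro ε hε
      obtain ⟨δ, hδ, hδε⟩ : ∃ δ : ℝ, 0 < δ ∧ (K : ℝ≥0∞) * ENNReal.ofReal δ < ε := by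
        have : Tendsto (fun δ : ℝ => (K : ℝ≥0∞) * ENNReal.ofReal δ) (𝓝[>] 0) (𝓝 0) := by
          have h3 : Continuous fun δ : ℝ => (K : ℝ≥0∞) * ENNReal.ofReal δ :=
            (ENNReal.continuous_const_mul ENNReal.coe_ne_top).comp ENNReal.continuous_ofReal
          have := h3.tendsto 0
          simp only [ENNReal.ofReal_zero, mul_zero] at this
          exact this.mono_left nhdsWithin_le_nhds
        obtain ⟨δ, h3, h4⟩ := ((this.eventually (gt_mem_nhds hε)).and self_mem_nhdsWithin).exists
        exact ⟨δ, h4, h3⟩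
      have h3 : Tendsto (fun n => (K : ℝ≥0∞) * (ENNReal.ofReal δ + ENNReal.ofReal δ⁻¹ *
          ∫⁻ p, ENNReal.ofReal (dist p.1 p.2 ^ 2) ∂(Pl n))) atTop
          (𝓝 ((K : ℝ≥0∞) * (ENNReal.ofReal δ + ENNReal.ofReal δ⁻¹ * 0))) := by
        refine ENNReal.Tendsto.const_mul ?_ (Or.inr ENNReal.coe_ne_top)
        exact tendsto_const_nhds.add (ENNReal.Tendsto.const_mul hlim (Or.inr ENNReal.ofReal_ne_top))
      rw [mul_zero, add_zero] at h3
      filter_upwards [h3.eventually (gt_mem_nhds hδε)] with n hn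
      exact (hle n δ hδ).trans hn.le
    have := (ENNReal.tendsto_toReal ENNReal.zero_ne_top).comp hE
    refine this.congr fun n => ?_
    simp [ENNReal.toReal_ofReal dist_nonneg]
  intro f
  exact (ProbabilityMeasure.tendsto_iff_forall_integral_tendsto.1 key) f

lemma W2sq_eval_le {d : ℕ} {T : ℝ} (hT : 0 < T) (Q Q' : Measure (Traj d T))
    (Pl : Measure (Traj d T × Traj d T)) (h1 : Pl.map Prod.fst = Q) (h2 : Pl.map Prod.snd = Q')
    (t : ℝ) :
    W2sq (Q.map (evalAt hT.le t)) (Q'.map (evalAt hT.le t)) ≤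
      ∫⁻ p, ENNReal.ofReal (dist p.1 p.2 ^ 2) ∂Pl := by
  have hem : Measurable (evalAt (d := d) hT.le t) := (continuous_evalAt hT.le t).measurable
  have hm : Measurable (Prod.map (evalAt (d := d) hT.le t) (evalAt (d := d) hT.le t)) :=
    hem.prodMap hem
  refine (iInf₂_le (Pl.map (Prod.map (evalAt hT.le t) (evalAt hT.le t))) ⟨?_, ?_⟩).trans ?_
  · rw [lintegral_map (by fun_prop) hm]
    refine lintegral_mono fun p => ?_
    refine ENNReal.ofReal_le_ofReal ?_
    have : dist (evalAt hT.le t p.1) (evalAt hT.le t p.2) ≤ dist p.1 p.2 :=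
      ContinuousMap.dist_apply_le_dist _
    simp only [Prod.map_fst, Prod.map_snd]
    gcongr
  · rw [Measure.map_map measurable_fst hm, ← h1, Measure.map_map hem measurable_fst]
    rfl
  · rw [Measure.map_map measurable_snd hm, ← h2, Measure.map_map hem measurable_snd]
    rfl

lemma moreau_eval_le {d : ℕ} {T : ℝ} (hT : 0 < T) (Ω : Set (Euc d))
    (F : Measure (Euc d) → ℝ≥0∞) (hFsupp : ∀ ρ : Measure (Euc d), F ρ ≠ ⊤ → ρ Ωᶜ = 0)
    (Q Q' : Measure (Traj d T)) (hQ' : IsProbabilityMeasure Q')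
    (Pl : Measure (Traj d T × Traj d T)) (h1 : Pl.map Prod.fst = Q) (h2 : Pl.map Prod.snd = Q')
    (ε : ℝ) (t : ℝ) :
    moreau Ω F ε (Q.map (evalAt hT.le t)) ≤
      (∫⁻ p, ENNReal.ofReal (dist p.1 p.2 ^ 2) ∂Pl) / ENNReal.ofReal (2 * ε) +
        F (Q'.map (evalAt hT.le t)) := by
  by_cases h : F (Q'.map (evalAt hT.le t)) = ⊤
  · rw [h]; simp
  have hem : Measurable (evalAt (d := d) hT.le t) := (continuous_evalAt hT.le t).measurable
  refine (iInf₂_le (Q'.map (evalAt hT.le t))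
    ⟨Measure.isProbabilityMeasure_map hem.aemeasurable, hFsupp _ h⟩).trans ?_
  gcongr
  exact W2sq_eval_le hT Q Q' Pl h1 h2 t

lemma Jeps_le {d : ℕ} {T : ℝ} (hT : 0 < T) (Ω : Set (Euc d)) (L : Euc d → ℝ) (C : ℝ)
    (F : Measure (Euc d) → ℝ≥0∞) (hFsupp : ∀ ρ : Measure (Euc d), F ρ ≠ ⊤ → ρ Ωᶜ = 0)
    (G : Measure (Traj d T) → ℝ)
    (Q Q' : Measure (Traj d T)) (hQ' : IsProbabilityMeasure Q')
    (Pl : Measure (Traj d T × Traj d T)) (h1 : Pl.map Prod.fst = Q) (h2 : Pl.map Prod.snd = Q')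
    (hA : ∫⁻ γ, actionN L C γ ∂Q ≤ ∫⁻ γ, actionN L C γ ∂Q') (ε : ℝ) (η : ℝ≥0∞)
    (hη : ∫⁻ p, ENNReal.ofReal (dist p.1 p.2 ^ 2) ∂Pl ≤ η) :
    Jeps hT.le Ω L C F G ε Q ≤ kinE L C Q' +
      ((η / ENNReal.ofReal (2 * ε) * ENNReal.ofReal T +
        ∫⁻ t in Set.Ioc (0:ℝ) T, F (Q'.map (evalAt hT.le t)) : ℝ≥0∞) : EReal) +
      ((G Q : ℝ) : EReal) := by
  unfold Jeps kinE
  refine add_le_add (add_le_add ?_ (EReal.coe_ennreal_le_coe_ennreal_iff.2 ?_)) le_rfl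
  · exact EReal.sub_le_sub (by exact_mod_cast hA) le_rfl
  · calc _ ≤ ∫⁻ t in Set.Ioc (0:ℝ) T, (η / ENNReal.ofReal (2 * ε) +
          F (Q'.map (evalAt hT.le t))) := by
          refine lintegral_mono fun t => ?_
          refine (moreau_eval_le hT Ω F hFsupp Q Q' hQ' Pl h1 h2 ε t).trans ?_
          gcongr
      _ = _ := by
          rw [lintegral_add_left measurable_const]
          simp

lemma small_tend (ε : ℕ → ℝ) (hεpos : ∀ N, 0 < ε N) :
    Tendsto (fun N : ℕ => ENNReal.ofReal (ε N / (N + 1)) / ENNReal.ofReal (ε N)) atTop (𝓝 0) := by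
  have h1 : ∀ N : ℕ, ENNReal.ofReal (ε N / (N + 1)) / ENNReal.ofReal (ε N) =
      ENNReal.ofReal (1 / ((N : ℝ) + 1)) := by
    intro N
    rw [← ENNReal.ofReal_div_of_pos (hεpos N)]
    congr 1
    have := (hεpos N).ne'
    field_simp
  simp_rw [h1]
  have := ENNReal.tendsto_ofReal (tendsto_one_div_add_atTop_nhds_zero_nat (𝕜 := ℝ))
  simpa using this

lemma eventually_ne_top (ε : ℕ → ℝ) (a : ℕ → ℝ≥0∞)
    (h : Tendsto (fun N => a N / ENNReal.ofReal (ε N)) atTop (𝓝 0)) :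
    ∀ᶠ N in atTop, a N ≠ ⊤ := by
  filter_upwards [h.eventually (gt_mem_nhds (zero_lt_one))] with N hN h1
  rw [h1, ENNReal.top_div_of_ne_top ENNReal.ofReal_ne_top] at hN
  simp at hN

/-- **Upper bound.** Assume `ε_N → 0`, `μ⁰_N ∈ P_N(Ω)` converges narrowly
to `μ⁰`, `τ_N = o(ε_N)` (where `τ_N` is the optimal quantization error of `Q_min` in the
2-Wasserstein distance over the Sobolev space `H = H^s`) and `W₂²(μ⁰_N, μ⁰) = o(ε_N)`.
Then, for any sequence `(Q_N)` of minimizers of `(M_{N,μ⁰_N,ε_N})`,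
`limsup_N J_{ε_N}(Q_N) ≤ J(Q_min)`. -/
theorem gamma_upper_bound
    (d : ℕ) (T : ℝ) (hT : 0 < T)
    (Ω : Set (Euc d)) (hΩc : IsCompact Ω) (hΩmeas : MeasurableSet Ω) (hΩne : Ω.Nonempty)
    (r C : ℝ) (hr : 1 < r) (hC : 0 < C)
    (L : Euc d → ℝ) (hLconv : ConvexOn ℝ Set.univ L) (hLcont : Continuous L)
    (hLgrow : ∀ p : Euc d, 1 / (r * C) * ‖p‖ ^ r - C ≤ L p ∧ L p ≤ C / r * ‖p‖ ^ r + C)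
    (F : Measure (Euc d) → ℝ≥0∞)
    (hFlsc : ∀ (ρ : ℕ → Measure (Euc d)) (σ : Measure (Euc d)),
      (∀ n, IsFiniteMeasure (ρ n)) → IsFiniteMeasure σ → NarrowTendsto ρ σ →
      F σ ≤ liminf (fun n => F (ρ n)) atTop)
    (hFsupp : ∀ ρ : Measure (Euc d), F ρ ≠ ⊤ → ρ Ωᶜ = 0)
    (G : Measure (Traj d T) → ℝ)
    (hGcont : ∀ (Q : ℕ → Measure (Traj d T)) (Q' : Measure (Traj d T)),
      (∀ n, IsProbabilityMeasure (Q n)) → IsProbabilityMeasure Q' →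
      NarrowTendsto Q Q' → Tendsto (fun n => G (Q n)) atTop (𝓝 (G Q')))
    (hGbdd : BddBelow (Set.range G))
    (μ0 : Measure (Euc d)) (hμ0 : IsProbabilityMeasure μ0)
    (hμ0Ω : μ0 Ωᶜ = 0) (hμ0ac : μ0 ≪ volume)
    -- `Q_min`, a minimizer of the continuous problem
    (Qmin : Measure (Traj d T)) (hQminP : IsProbabilityMeasure Qmin)
    (hQmin0 : Qmin.map (evalAt hT.le 0) = μ0)
    (hQminmin : ∀ Q : Measure (Traj d T), IsProbabilityMeasure Q →
      Q.map (evalAt hT.le 0) = μ0 → Jfun hT.le L C F G Qmin ≤ Jfun hT.le L C F G Q)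
    -- the Sobolev space `H = H^s` carrying `Q_min`, and the quantization error `τ_N`
    (H : Type*) [NormedAddCommGroup H] [InnerProductSpace ℝ H] [CompleteSpace H]
    [SecondCountableTopology H] [MeasurableSpace H] [BorelSpace H]
    (ι : H →L[ℝ] Traj d T) (hι : Function.Injective ι) (hιcpt : IsCompactOperator ι)
    (R : Measure H) (hR : IsProbabilityMeasure R) (hRι : R.map ι = Qmin)
    (τ : ℕ → ℝ≥0∞)
    (hτ : ∀ N, τ N = ⨅ (P : Measure H) (_ : IsUnifDiscrete N P), W2sq P R)
    -- the parameters of the discretization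
    (ε : ℕ → ℝ) (hεpos : ∀ N, 0 < ε N) (hεlim : Tendsto ε atTop (𝓝 0))
    (μ0N : ℕ → Measure (Euc d))
    (hμ0N : ∀ N, IsUnifDiscrete N (μ0N N) ∧ (μ0N N) Ωᶜ = 0)
    (hμ0Ncv : NarrowTendsto μ0N μ0)
    (hτsmall : Tendsto (fun N => τ N / ENNReal.ofReal (ε N)) atTop (𝓝 0))
    (hW2small : Tendsto (fun N => W2sq (μ0N N) μ0 / ENNReal.ofReal (ε N)) atTop (𝓝 0))
    -- a sequence of minimizers of the discretized problems
    (Q : ℕ → Measure (Traj d T))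
    (hQdisc : ∀ N, IsUnifDiscrete N (Q N) ∧ (Q N).map (evalAt hT.le 0) = μ0N N)
    (hQmin : ∀ N, ∀ Q' : Measure (Traj d T), IsUnifDiscrete N Q' →
      Q'.map (evalAt hT.le 0) = μ0N N →
      Jeps hT.le Ω L C F G (ε N) (Q N) ≤ Jeps hT.le Ω L C F G (ε N) Q') :
    limsup (fun N => Jeps hT.le Ω L C F G (ε N) (Q N)) atTop ≤ Jfun hT.le L C F G Qmin := by
  subst hRι
  subst hQmin0
  set Qm : Measure (Traj d T) := R.map ι with hQm
  set J0 := Jfun hT.le L C F G Qm with hJ0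
  by_cases hA : ∫⁻ γ, actionN L C γ ∂Qm = ⊤
  · have : J0 = ⊤ := by
      rw [hJ0]
      unfold Jfun kinE
      rw [hA, EReal.coe_ennreal_top, EReal.top_sub_coe, EReal.top_add_of_ne_bot (by simp),
        EReal.top_add_coe]
    rw [this]; exact le_top
  by_cases hB : ∫⁻ t in Set.Ioc (0:ℝ) T, F (Qm.map (evalAt hT.le t)) = ⊤
  · have : J0 = ⊤ := by
      rw [hJ0]
      unfold Jfun kinE
      lift (∫⁻ γ, actionN L C γ ∂Qm) to ℝ≥0 using hA with A
      rw [hB, EReal.coe_ennreal_top]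
      have : ((A : ℝ≥0∞) : EReal) - ((C * T : ℝ) : EReal) = (((A : ℝ) - C * T : ℝ) : EReal) := by
        rfl
      rw [this, EReal.coe_add_top, EReal.top_add_coe]
    rw [this]; exact le_top
  set W : ℕ → ℝ≥0∞ := fun N => W2sq (μ0N N) (Qm.map (evalAt hT.le 0)) with hW
  set δ : ℕ → ℝ≥0∞ := fun N => ENNReal.ofReal (ε N / (N + 1)) with hδ
  have hδpos : ∀ N, 0 < δ N := fun N => by
    simp only [hδ, ENNReal.ofReal_pos]
    have := hεpos N
    positivity
  set κ2 : ℝ≥0∞ := ENNReal.ofReal (‖ι‖ ^ 2) with hκ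
  set η : ℕ → ℝ≥0∞ := fun N => 4 * (W N + δ N) + 6 * κ2 * (τ N + δ N) with hη
  have hδs : Tendsto (fun N => δ N / ENNReal.ofReal (ε N)) atTop (𝓝 0) := small_tend ε hεpos
  have hηs : Tendsto (fun N => η N / ENNReal.ofReal (ε N)) atTop (𝓝 0) := by
    have h1 := ENNReal.Tendsto.const_mul (a := 4) (hW2small.add hδs) (Or.inr (by simp))
    have h2 := ENNReal.Tendsto.const_mul (a := 6 * κ2) (hτsmall.add hδs)
      (Or.inr (ENNReal.mul_ne_top (by simp) ENNReal.ofReal_ne_top))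
    have h3 := h1.add h2
    simp only [add_zero, mul_zero] at h3
    refine h3.congr fun N => ?_
    simp only [hη, hW, div_eq_mul_inv]
    ring
  have hη0 : Tendsto η atTop (𝓝 0) := by
    have h1 : Tendsto (fun N => ENNReal.ofReal (ε N)) atTop (𝓝 0) := by
      simpa using ENNReal.tendsto_ofReal hεlim
    have h2 := ENNReal.Tendsto.mul hηs (Or.inr (by simp)) h1 (Or.inr (by simp))
    simp only [mul_zero] at h2
    refine h2.congr fun N => ?_
    exact ENNReal.div_mul_cancel (by simpa using hεpos N) ENNReal.ofReal_ne_top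
  have hex : ∀ N, ∃ (Q' : Measure (Traj d T)) (Pl : Measure (Traj d T × Traj d T)),
      (IsProbabilityMeasure Q' ∧ IsProbabilityMeasure Pl ∧ Pl.map Prod.fst = Q' ∧
        Pl.map Prod.snd = Qm) ∧
      ∫⁻ p, ENNReal.ofReal (dist p.1 p.2 ^ 2) ∂Pl ≤ η N ∧
      ((N ≠ 0 ∧ τ N ≠ ⊤ ∧ W N ≠ ⊤) → IsUnifDiscrete N Q' ∧
        Q'.map (evalAt hT.le 0) = μ0N N ∧
        ∫⁻ γ, actionN L C γ ∂Q' ≤ ∫⁻ γ, actionN L C γ ∂Qm) := by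
    intro N
    by_cases hgood : N ≠ 0 ∧ τ N ≠ ⊤ ∧ W N ≠ ⊤
    · obtain ⟨hN, hτN, hWN⟩ := id hgood
      have h1 : τ N < τ N + δ N := ENNReal.lt_add_right hτN (hδpos N).ne'
      have h2 : W N < W N + δ N := ENNReal.lt_add_right hWN (hδpos N).ne'
      nth_rewrite 1 [hτ N] at h1
      nth_rewrite 1 [hW] at h2
      obtain ⟨P, hP⟩ := iInf_lt_iff.1 h1
      obtain ⟨hPu, hP⟩ := iInf_lt_iff.1 hP
      obtain ⟨π, hπ⟩ := iInf_lt_iff.1 hP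
      obtain ⟨⟨hπ1, hπ2⟩, hπ⟩ := iInf_lt_iff.1 hπ
      obtain ⟨π', hπ'⟩ := iInf_lt_iff.1 h2
      obtain ⟨⟨hπ1', hπ2'⟩, hπ'⟩ := iInf_lt_iff.1 hπ'
      obtain ⟨Q', Pl, hpr, hu, h0, ha, hc⟩ := build hT L hr hC hLconv hLcont
        (fun p => (hLgrow p).1) ι R N hN P hPu π hπ1 hπ2 hπ.ne_top (μ0N N) (hμ0N N).1 π' hπ1' hπ2'
      refine ⟨Q', Pl, hpr, hc.trans ?_, fun _ => ⟨hu, h0, ha⟩⟩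
      simp only [hη]
      gcongr
    · have hm : Measurable fun γ : Traj d T => (γ, γ) := measurable_id.prodMk measurable_id
      refine ⟨Qm, Qm.map (fun γ => (γ, γ)), ⟨hQminP,
        Measure.isProbabilityMeasure_map hm.aemeasurable, ?_, ?_⟩, ?_, fun h => (hgood h).elim⟩
      · rw [Measure.map_map measurable_fst hm]
        exact Measure.map_id
      · rw [Measure.map_map measurable_snd hm]
        exact Measure.map_id
      · rw [lintegral_map (by fun_prop) hm]
        simp
  choose Q' Pl hpr hcost hgood using hex
  have hnar : NarrowTendsto Q' Qm := narrow_of_coupling Q' Qm (fun N => (hpr N).1) hQminP Pl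
    (fun N => (hpr N).2.1) (fun N => (hpr N).2.2.1) (fun N => (hpr N).2.2.2)
    (tendsto_of_tendsto_of_tendsto_of_le_of_le tendsto_const_nhds hη0 (fun _ => zero_le)
      hcost)
  have hG := hGcont Q' Qm (fun N => (hpr N).1) hQminP hnar
  have hev : ∀ᶠ N in atTop, Jeps hT.le Ω L C F G (ε N) (Q N) ≤ kinE L C Qm +
      ((η N / ENNReal.ofReal (2 * ε N) * ENNReal.ofReal T +
        ∫⁻ t in Set.Ioc (0:ℝ) T, F (Qm.map (evalAt hT.le t)) : ℝ≥0∞) : EReal) +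
      ((G (Q' N) : ℝ) : EReal) := by
    filter_upwards [eventually_ne_atTop 0, eventually_ne_top ε τ hτsmall,
      eventually_ne_top ε W hW2small] with N h1 h2 h3
    obtain ⟨hu, h0, ha⟩ := hgood N ⟨h1, h2, h3⟩
    exact (hQmin N (Q' N) hu h0).trans (Jeps_le hT Ω L C F hFsupp G (Q' N) Qm hQminP (Pl N)
      (hpr N).2.2.1 (hpr N).2.2.2 ha (ε N) (η N) (hcost N))
  set B := ∫⁻ t in Set.Ioc (0:ℝ) T, F (Qm.map (evalAt hT.le t)) with hBdef
  have hηT : Tendsto (fun N => η N / ENNReal.ofReal (2 * ε N) * ENNReal.ofReal T + B) atTop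
      (𝓝 B) := by
    have h1 : Tendsto (fun N => η N / ENNReal.ofReal (2 * ε N)) atTop (𝓝 0) := by
      refine tendsto_of_tendsto_of_tendsto_of_le_of_le tendsto_const_nhds hηs
        (fun _ => zero_le) fun N => ?_
      refine ENNReal.div_le_div_left (ENNReal.ofReal_le_ofReal ?_) _
      linarith [hεpos N]
    have h2 := ENNReal.Tendsto.mul_const h1 (b := ENNReal.ofReal T) (Or.inr (by simp))
    have h3 := h2.add_const B
    simpa using h3
  have hkin : ∃ k : ℝ, kinE L C Qm = (k : EReal) := by
    unfold kinE
    lift (∫⁻ γ, actionN L C γ ∂Qm) to ℝ≥0 using hA with A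
    exact ⟨(A : ℝ) - C * T, rfl⟩
  obtain ⟨k, hk⟩ := hkin
  have hBr : ∃ b : ℝ, ((B : ℝ≥0∞) : EReal) = (b : EReal) := by
    lift B to ℝ≥0 using hB with B'
    exact ⟨B', rfl⟩
  obtain ⟨b, hb⟩ := hBr
  have hlim : Tendsto (fun N => kinE L C Qm +
      ((η N / ENNReal.ofReal (2 * ε N) * ENNReal.ofReal T + B : ℝ≥0∞) : EReal) +
      ((G (Q' N) : ℝ) : EReal)) atTop (𝓝 J0) := by
    have hE1 : Tendsto (fun N => ((η N / ENNReal.ofReal (2 * ε N) * ENNReal.ofReal T + B :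
        ℝ≥0∞) : EReal)) atTop (𝓝 ((B : ℝ≥0∞) : EReal)) :=
      (continuous_coe_ennreal_ereal.tendsto B).comp hηT
    have hE2 : Tendsto (fun N => ((G (Q' N) : ℝ) : EReal)) atTop (𝓝 ((G Qm : ℝ) : EReal)) :=
      (continuous_coe_real_ereal.tendsto _).comp hG
    have hJ : J0 = kinE L C Qm + ((B : ℝ≥0∞) : EReal) + ((G Qm : ℝ) : EReal) := rfl
    rw [hJ]
    have hE3 : Tendsto (fun N => kinE L C Qm + ((η N / ENNReal.ofReal (2 * ε N) *
        ENNReal.ofReal T + B : ℝ≥0∞) : EReal)) atTop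
        (𝓝 (kinE L C Qm + ((B : ℝ≥0∞) : EReal))) := by
      have hc : ContinuousAt (fun p : EReal × EReal => p.1 + p.2)
          (kinE L C Qm, ((B : ℝ≥0∞) : EReal)) := by
        rw [hk, hb]
        exact EReal.continuousAt_add (by simp) (by simp)
      exact hc.tendsto.comp (tendsto_const_nhds.prodMk_nhds hE1)
    have hc : ContinuousAt (fun p : EReal × EReal => p.1 + p.2)
        (kinE L C Qm + ((B : ℝ≥0∞) : EReal), ((G Qm : ℝ) : EReal)) := by
      rw [hk, hb, ← EReal.coe_add]
      exact EReal.continuousAt_add (by simp) (by simp)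
    exact hc.tendsto.comp (hE3.prodMk_nhds hE2)
  exact (limsup_le_limsup hev).trans hlim.limsup_eq.le
end

section
/- Let X be a metric space and Q ∈ P(X) be supported on a subset Σ ⊂ X. Define the optimal quantization radius τ_N = min_{Q̃ ∈ P_N(X)} W²_{d_X,2}(Q, Q̃) and the optimal covering radius r_N = inf { d_H(Σ, P) : P ⊂ X, |P| ≤ N } (d_H the Hausdorff distance). If r_N = O(N^{−1/D}) as N → ∞ for some D > 0, then τ_N = O(N^{−1}) if D < 2, τ_N = O(N^{−1} ln N) if D = 2, and τ_N = O(N^{−2/D}) if D > 2. -/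
open MeasureTheory Filter Topology Set
open scoped ENNReal NNReal

noncomputable section

/-- the optimal quantization radius `τ_N` of a measure `Q` -/
def quantRadius {X : Type*} [MeasurableSpace X] [PseudoMetricSpace X]
    (N : ℕ) (Q : Measure X) : ℝ≥0∞ :=
  ⨅ (P : Measure X) (_ : IsUnifDiscrete N P), W2sq Q P

/-- the optimal covering radius `r_N` of a set `Σ` -/
def coverRadius {X : Type*} [PseudoMetricSpace X] (N : ℕ) (Sig : Set X) : ℝ≥0∞ :=
  ⨅ (P : Finset X) (_ : P.card ≤ N), EMetric.hausdorffEdist Sig (P : Set X)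

theorem greedy_coupling {X : Type*} [MetricSpace X] [MeasurableSpace X] [BorelSpace X]
    (Sig : Set X) (R : ℕ → ℝ) (hR : ∀ n, 0 ≤ R n)
    (hcov : ∀ n : ℕ, ∃ P : Finset X, P.card ≤ n + 1 ∧ ∀ x ∈ Sig, ∃ p ∈ P, dist x p < R n)
    (w : ℝ≥0∞) (hw0 : w ≠ 0) (hw : w ≠ ⊤) (k : ℕ) :
    ∀ μ : Measure X, μ Sigᶜ = 0 → μ univ = k * w →
      ∃ (x : Fin k → X) (π : Measure (X × X)), π.map Prod.fst = μ ∧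
        π.map Prod.snd = w • ∑ i, Measure.dirac (x i) ∧
        ∫⁻ p, ENNReal.ofReal (dist p.1 p.2 ^ 2) ∂π
          ≤ w * ∑ i ∈ Finset.range k, ENNReal.ofReal (R i ^ 2) := by
  induction k with
  | zero =>
    intro μ _ hμ
    have : μ = 0 := by simpa using hμ
    exact ⟨Fin.elim0, 0, by simp [this], by simp, by simp⟩
  | succ k ih =>
    intro μ hS hμ
    obtain ⟨P, hPc, hP⟩ := hcov k
    have hfin : μ univ ≠ ⊤ := by
      rw [hμ]; exact ENNReal.mul_ne_top (ENNReal.natCast_ne_top _) hw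
   
    obtain ⟨p, hpP, hp⟩ : ∃ p ∈ P, w ≤ μ (Metric.ball p (R k)) := by
      by_contra! hcon
      have h1 : μ univ ≤ ∑ p ∈ P, μ (Metric.ball p (R k)) := by
        calc μ univ ≤ μ (Sig ∪ Sigᶜ) := by simp
          _ ≤ μ Sig + μ Sigᶜ := measure_union_le _ _
          _ = μ Sig := by rw [hS, add_zero]
          _ ≤ μ (⋃ p ∈ P, Metric.ball p (R k)) := by
            apply measure_mono
            intro x hx
            obtain ⟨p, hp, hd⟩ := hP x hx
            simp only [mem_iUnion]
            exact ⟨p, hp, hd⟩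
          _ ≤ _ := measure_biUnion_finset_le _ _
      have hne : P.Nonempty := by
        by_contra hemp
        rw [Finset.not_nonempty_iff_eq_empty] at hemp
        rw [hemp, hμ] at h1
        simp [hw0] at h1
      have h2 : ∑ p ∈ P, μ (Metric.ball p (R k)) < ∑ p ∈ P, w :=
        ENNReal.sum_lt_sum_of_nonempty hne hcon
      have h3 : ∑ p ∈ P, w ≤ ((k + 1 : ℕ) : ℝ≥0∞) * w := by
        rw [Finset.sum_const, nsmul_eq_mul]
        gcongr
      exact absurd (h1.trans_lt (h2.trans_le h3)) (by rw [hμ]; exact lt_irrefl _)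
    set B := Metric.ball p (R k) with hB
    have hBm : MeasurableSet B := Metric.isOpen_ball.measurableSet
    have hB0 : μ B ≠ 0 := fun h => hw0 (by simpa [h] using hp)
    have hBt : μ B ≠ ⊤ := ne_top_of_le_ne_top hfin (measure_mono (subset_univ _))
    set c : ℝ≥0∞ := w / μ B with hc
    have hc1 : c ≤ 1 := ENNReal.div_le_of_le_mul (by simpa using hp)
    have hcB : c * μ B = w := ENNReal.div_mul_cancel hB0 hBt
    set ν : Measure X := c • μ.restrict B with hν
    set μr : Measure X := μ.restrict Bᶜ + (1 - c) • μ.restrict B with hμr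
    have hsum : μr + ν = μ := by
      rw [hμr, hν, add_assoc, ← add_smul, tsub_add_cancel_of_le hc1, one_smul, add_comm]
      exact Measure.restrict_add_restrict_compl hBm
    have hνu : ν univ = w := by simp [hν, hcB]
    have hμru : μr univ = k * w := by
      have : μr univ + w = k * w + w := by
        rw [← hνu, ← Measure.add_apply, hsum, hμ, hνu]; push_cast; ring
      exact (ENNReal.add_left_inj hw).1 this
    have hμrS : μr Sigᶜ = 0 := by
      have : μr Sigᶜ ≤ μ Sigᶜ := by
        conv_rhs => rw [← hsum]
        rw [Measure.add_apply]; exact le_self_add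
      exact le_antisymm (this.trans hS.le) (by simp)
    obtain ⟨x, π, h1, h2, h3⟩ := ih μr hμrS hμru
    have hg : Measurable (fun y : X => (y, p)) := by fun_prop
    refine ⟨Fin.cons p x, π + ν.map (fun y => (y, p)), ?_, ?_, ?_⟩
    · rw [Measure.map_add _ _ measurable_fst, h1, Measure.map_map measurable_fst hg]
      have : (Prod.fst ∘ fun y : X => (y, p)) = id := rfl
      rw [this, Measure.map_id, hsum]
    · rw [Measure.map_add _ _ measurable_snd, h2, Measure.map_map measurable_snd hg]
      have : (Prod.snd ∘ fun y : X => (y, p)) = fun _ => p := rfl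
      rw [this, Measure.map_const, hνu, Fin.sum_univ_succ]
      simp [add_comm]
    · rw [lintegral_add_measure, Finset.sum_range_succ, mul_add]
      refine add_le_add h3 ((lintegral_map_le _ _).trans ?_)
      rw [hν, lintegral_smul_measure, smul_eq_mul]
      calc c * ∫⁻ y in B, ENNReal.ofReal (dist y p ^ 2) ∂μ
          ≤ c * ∫⁻ y in B, ENNReal.ofReal (R k ^ 2) ∂μ := by
            refine mul_le_mul_right ?_ _
            refine setLIntegral_mono' hBm fun y hy => ?_
            apply ENNReal.ofReal_le_ofReal
            have : dist y p < R k := hy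
            gcongr
        _ = w * ENNReal.ofReal (R k ^ 2) := by
            rw [setLIntegral_const, mul_comm _ (μ B), ← mul_assoc, hcB]

theorem quant_le_sum {X : Type*} [MetricSpace X] [MeasurableSpace X] [BorelSpace X]
    (Q : Measure X) (hQ : IsProbabilityMeasure Q)
    (Sig : Set X) (hsupp : Q Sigᶜ = 0) (D K : ℝ) (hK : 0 < K)
    (hcov : ∀ N : ℕ, 1 ≤ N →
      coverRadius N Sig ≤ ENNReal.ofReal (K * (N : ℝ) ^ (-(1 / D)))) (N : ℕ) (hN : 1 ≤ N) :
    quantRadius N Q ≤ ENNReal.ofReal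
      (4 * K ^ 2 * ((N : ℝ)⁻¹ * ∑ i ∈ Finset.range N, ((i + 1 : ℕ) : ℝ) ^ (-(2 / D)))) := by
  have hpos : ∀ n : ℕ, 0 < K * ((n + 1 : ℕ) : ℝ) ^ (-(1 / D)) := fun n => by positivity
  have hN0 : (N : ℝ≥0∞) ≠ 0 := by simp; omega
  obtain ⟨x, π, h1, h2, h3⟩ := greedy_coupling Sig
    (fun n => 2 * (K * ((n + 1 : ℕ) : ℝ) ^ (-(1 / D)))) (fun n => by positivity)
    (by
      intro n
      have h := (hcov (n + 1) (by omega)).trans_lt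
        ((ENNReal.ofReal_lt_ofReal_iff (by linarith [hpos n])).2
          (show _ < 2 * (K * ((n + 1 : ℕ) : ℝ) ^ (-(1 / D))) by linarith [hpos n]))
      unfold coverRadius at h
      simp only [iInf_lt_iff] at h
      obtain ⟨P, hc, hP⟩ := h
      refine ⟨P, hc, fun x hx => ?_⟩
      obtain ⟨p, hp, hd⟩ := EMetric.exists_edist_lt_of_hausdorffEdist_lt hx hP
      refine ⟨p, hp, ?_⟩
      rw [edist_dist] at hd
      exact (ENNReal.ofReal_lt_ofReal_iff (by linarith [hpos n])).1 hd)
    (N : ℝ≥0∞)⁻¹ (by simp) (by simp; omega) N Q hsupp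
    (by rw [measure_univ, ENNReal.mul_inv_cancel hN0 (by simp)])
  calc quantRadius N Q ≤ W2sq Q ((N : ℝ≥0∞)⁻¹ • ∑ i, Measure.dirac (x i)) :=
        iInf₂_le _ ⟨x, rfl⟩
    _ ≤ _ := iInf₂_le π ⟨h1, h2⟩
    _ ≤ _ := h3
    _ = _ := by
      rw [← ENNReal.ofReal_sum_of_nonneg (fun i _ => by positivity), ← ENNReal.ofReal_natCast,
        ← ENNReal.ofReal_inv_of_pos (by exact_mod_cast hN),
        ← ENNReal.ofReal_mul (by positivity)]
      congr 1
      rw [mul_left_comm, Finset.mul_sum _ _ (4 * K ^ 2)]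
      congr 1
      refine Finset.sum_congr rfl fun i _ => ?_
      have : ((i + 1 : ℕ) : ℝ) ^ (-(2 / D)) = (((i + 1 : ℕ) : ℝ) ^ (-(1 / D))) ^ 2 := by
        rw [← Real.rpow_natCast, ← Real.rpow_mul (by positivity)]
        congr 1; push_cast; ring
      rw [this]; ring

theorem sum_rpow_le (s : ℝ) (hs0 : 0 < s) (hs : s < 1) (N : ℕ) :
    ∑ i ∈ Finset.range N, ((i + 1 : ℕ) : ℝ) ^ (-s) ≤ (N : ℝ) ^ (1 - s) / (1 - s) := by
  induction N with
  | zero => simp [Real.zero_rpow (show 1 - s ≠ 0 by linarith)]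
  | succ n ih =>
    rw [Finset.sum_range_succ]
    have hs1 : 0 < 1 - s := by linarith
    set m : ℝ := ((n + 1 : ℕ) : ℝ) with hm
    have hmp : 0 < m := by positivity
    have hm1 : 1 ≤ m := by rw [hm]; exact_mod_cast Nat.succ_pos n
    have hn : (n : ℝ) = m * (1 + -m⁻¹) := by
      rw [hm]; push_cast; field_simp; ring
    have hinv : m⁻¹ ≤ 1 := inv_le_one_of_one_le₀ hm1
    have hb := rpow_one_add_le_one_add_mul_self (s := -m⁻¹) (p := 1 - s)
      (by linarith) hs1.le (by linarith)
    have h1 : (n : ℝ) ^ (1 - s) ≤ m ^ (1 - s) * (1 + (1 - s) * -m⁻¹) := by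
      rw [hn, Real.mul_rpow hmp.le (by linarith)]
      gcongr
    have h2 : m ^ (1 - s) * m⁻¹ = m ^ (-s) := by
      rw [← Real.rpow_neg_one, ← Real.rpow_add hmp]; congr 1; ring
    have h3 : m ^ (1 - s) * (1 + (1 - s) * -m⁻¹) = m ^ (1 - s) - (1 - s) * m ^ (-s) := by
      rw [← h2]; ring
    rw [h3] at h1
    have h4 : (n : ℝ) ^ (1 - s) / (1 - s) + m ^ (-s) ≤ m ^ (1 - s) / (1 - s) := by
      rw [div_add' _ _ _ hs1.ne', div_le_div_iff_of_pos_right hs1]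
      linarith
    linarith

/-- In a metric space `X`, let `Q ∈ P(X)` (with finite second moment) be
supported on `Σ ⊆ X`.  If the optimal covering radius satisfies `r_N = O(N^{-1/D})` then
the optimal quantization radius `τ_N` is `O(N^{-1})` if `D < 2`, `O(N^{-1} ln N)` if
`D = 2`, and `O(N^{-2/D})` if `D > 2`. -/
theorem quantization_from_covering
    (X : Type*) [MetricSpace X] [MeasurableSpace X] [BorelSpace X]
    (Q : Measure X) (hQ : IsProbabilityMeasure Q)
    (Sig : Set X) (hsupp : Q Sigᶜ = 0)
    (hmom : ∃ x₀ : X, ∫⁻ x, ENNReal.ofReal (dist x x₀ ^ 2) ∂Q ≠ ⊤)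
    (D : ℝ) (hD : 0 < D)
    (hcov : ∃ K : ℝ, 0 < K ∧ ∀ N : ℕ, 1 ≤ N →
      coverRadius N Sig ≤ ENNReal.ofReal (K * (N : ℝ) ^ (-(1 / D)))) :
    (D < 2 → ∃ K : ℝ, 0 < K ∧ ∀ N : ℕ, 1 ≤ N →
      quantRadius N Q ≤ ENNReal.ofReal (K * (N : ℝ)⁻¹)) ∧
    (D = 2 → ∃ K : ℝ, 0 < K ∧ ∀ N : ℕ, 2 ≤ N →
      quantRadius N Q ≤ ENNReal.ofReal (K * Real.log N / N)) ∧
    (2 < D → ∃ K : ℝ, 0 < K ∧ ∀ N : ℕ, 1 ≤ N →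
      quantRadius N Q ≤ ENNReal.ofReal (K * (N : ℝ) ^ (-(2 / D)))) := by
  obtain ⟨K, hK, hcov⟩ := hcov
  have key := quant_le_sum Q hQ Sig hsupp D K hK hcov
  refine ⟨fun h => ?_, fun h => ?_, fun h => ?_⟩
  · have hs : 1 < 2 / D := by rw [lt_div_iff₀ hD]; linarith
    have hsm : Summable fun i : ℕ => ((i + 1 : ℕ) : ℝ) ^ (-(2 / D)) :=
      (summable_nat_add_iff (f := fun i : ℕ => (i : ℝ) ^ (-(2 / D))) 1).2
        (Real.summable_nat_rpow.2 (by linarith))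
    have hnn : ∀ i : ℕ, 0 ≤ ((i + 1 : ℕ) : ℝ) ^ (-(2 / D)) := fun i => by positivity
    have ht : 0 ≤ ∑' i : ℕ, ((i + 1 : ℕ) : ℝ) ^ (-(2 / D)) := tsum_nonneg hnn
    refine ⟨4 * K ^ 2 * (1 + ∑' i : ℕ, ((i + 1 : ℕ) : ℝ) ^ (-(2 / D))), by positivity,
      fun N hN => (key N hN).trans (ENNReal.ofReal_le_ofReal ?_)⟩
    have hle := hsm.sum_le_tsum (Finset.range N) (fun i _ => hnn i)
    rw [mul_assoc (4 * K ^ 2), mul_comm (_ + _)]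
    gcongr
    linarith
  · subst h
    have hl2 : 0 < Real.log 2 := Real.log_pos (by norm_num)
    refine ⟨4 * K ^ 2 * (1 / Real.log 2 + 1), by positivity,
      fun N hN => (key N (by omega)).trans (ENNReal.ofReal_le_ofReal ?_)⟩
    have hsum : ∑ i ∈ Finset.range N, ((i + 1 : ℕ) : ℝ) ^ (-((2 : ℝ) / 2)) = (harmonic N : ℝ) := by
      rw [harmonic]; push_cast
      refine Finset.sum_congr rfl fun i _ => ?_
      rw [div_self (by norm_num), Real.rpow_neg_one]
    have hh := harmonic_le_one_add_log N
    have hlog : Real.log 2 ≤ Real.log N := Real.log_le_log (by norm_num) (by exact_mod_cast hN)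
    have h1 : 1 ≤ 1 / Real.log 2 * Real.log N := by
      rw [one_div, inv_mul_eq_div, le_div_iff₀ hl2]; linarith
    rw [hsum, mul_assoc (4 * K ^ 2), mul_div_assoc, div_eq_inv_mul]
    gcongr
    linarith
  · have hs : 2 / D < 1 := by rw [div_lt_one hD]; linarith
    have hs0 : 0 < 2 / D := by positivity
    have hs1 : 0 < 1 - 2 / D := by linarith
    refine ⟨4 * K ^ 2 * (1 - 2 / D)⁻¹, by positivity,
      fun N hN => (key N hN).trans (ENNReal.ofReal_le_ofReal ?_)⟩
    have hNp : (0 : ℝ) < N := by exact_mod_cast hN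
    have h2 : (N : ℝ)⁻¹ * (N : ℝ) ^ (1 - 2 / D) = (N : ℝ) ^ (-(2 / D)) := by
      rw [← Real.rpow_neg_one, ← Real.rpow_add hNp]; congr 1; ring
    rw [mul_assoc (4 * K ^ 2), ← h2]
    refine mul_le_mul_of_nonneg_left ?_ (by positivity)
    calc _ ≤ (N : ℝ)⁻¹ * ((N : ℝ) ^ (1 - 2 / D) / (1 - 2 / D)) := by
          gcongr
          exact sum_rpow_le _ hs0 hs N
      _ = _ := by rw [div_eq_mul_inv]; ring

end
end
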